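/- arXiv:2412.04863 — 10 statements merged into one kernel-verified Lean document; each statement's English description precedes it below -/
import Mathlib

section
/- For all complex numbers z₁, z₂ and every real t with |t| < 1, the series ∑_{l=0}^{∞} t^l/(2^l l!) · H_l(z₁) H_l(z₂) converges and equals (1−t²)^{−1/2} exp[(2t z₁ z₂ − t²(z₁² + z₂²))/(1−t²)]. -/
open Finset
open scoped Nat

/-- The physicists' Hermite polynomial
`H_n(z) = n! ∑_{m=0}^{⌊n/2⌋} (−1)^m (2z)^{n−2m} / (m!(n−2m)!)`, for a complex argument. -/
noncomputable def hermiteH (n : ℕ) (z : ℂ) : ℂ :=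
  (n ! : ℂ) * ∑ m ∈ Finset.range (n / 2 + 1),
    ((-1 : ℂ) ^ m * (2 * z) ^ (n - 2 * m)) / ((m ! : ℂ) * ((n - 2 * m)! : ℂ))

theorem hermiteH_eq_sum_ite {n N : ℕ} (hN : n < 2 * N) (z : ℂ) :
    hermiteH n z = (n ! : ℂ) * ∑ m ∈ Finset.range N, if 2 * m ≤ n then
      ((-1 : ℂ) ^ m * (2 * z) ^ (n - 2 * m)) / ((m ! : ℂ) * ((n - 2 * m)! : ℂ)) else 0 := by
  rw [hermiteH, ← Finset.sum_filter]
  congr 2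
  ext m
  simp only [Finset.mem_range, Finset.mem_filter]
  omega

theorem hermiteH_zero (z : ℂ) : hermiteH 0 z = 1 := by simp [hermiteH]

theorem hermiteH_one (z : ℂ) : hermiteH 1 z = 2 * z := by simp [hermiteH]

theorem hermiteH_add_two (n : ℕ) (z : ℂ) :
    hermiteH (n + 2) z = 2 * z * hermiteH (n + 1) z - 2 * (n + 1) * hermiteH n z := by
  rw [hermiteH_eq_sum_ite (n := n + 2) (N := n + 2) (by omega),
    hermiteH_eq_sum_ite (n := n + 1) (N := n + 2) (by omega),
    hermiteH_eq_sum_ite (n := n) (N := n + 1) (by omega),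
    Finset.sum_range_succ' _ (n + 1), Finset.sum_range_succ' _ (n + 1)]
  have key : ∀ m : ℕ, ((n : ℂ) + 2) * (if 2 * (m + 1) ≤ n + 2 then
      ((-1 : ℂ) ^ (m + 1) * (2 * z) ^ (n + 2 - 2 * (m + 1))) /
        (((m + 1)! : ℂ) * ((n + 2 - 2 * (m + 1))! : ℂ)) else 0) =
      2 * z * (if 2 * (m + 1) ≤ n + 1 then
      ((-1 : ℂ) ^ (m + 1) * (2 * z) ^ (n + 1 - 2 * (m + 1))) /
        (((m + 1)! : ℂ) * ((n + 1 - 2 * (m + 1))! : ℂ)) else 0) -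
      2 * (if 2 * m ≤ n then
      ((-1 : ℂ) ^ m * (2 * z) ^ (n - 2 * m)) / ((m ! : ℂ) * ((n - 2 * m)! : ℂ)) else 0) := by
    intro m
    have hm : (m ! : ℂ) ≠ 0 := by exact_mod_cast m.factorial_ne_zero
    have hm' : (m : ℂ) + 1 ≠ 0 := by exact_mod_cast m.succ_ne_zero
    rcases lt_or_ge n (2 * m) with h | h
    · rw [if_neg (by omega), if_neg (by omega), if_neg (by omega)]; ring
    · obtain ⟨k, rfl⟩ := Nat.exists_eq_add_of_le h
      rw [if_pos (by omega), if_pos h, show 2 * m + k + 2 - 2 * (m + 1) = k by omega,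
        show 2 * m + k - 2 * m = k by omega]
      rcases k with _ | k
      · rw [if_neg (by omega)]
        simp only [Nat.factorial_succ]
        push_cast
        field_simp
        ring
      · have hk : (k ! : ℂ) ≠ 0 := by exact_mod_cast k.factorial_ne_zero
        have hk' : (k : ℂ) + 1 ≠ 0 := by exact_mod_cast k.succ_ne_zero
        rw [if_pos (by omega), show 2 * m + (k + 1) + 1 - 2 * (m + 1) = k by omega]
        simp only [Nat.factorial_succ]
        push_cast
        field_simp
        ring
  have hsum := Finset.sum_congr (rfl : Finset.range (n + 1) = _) fun m _ => key m
  rw [← Finset.mul_sum, Finset.sum_sub_distrib, ← Finset.mul_sum, ← Finset.mul_sum] at hsum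
  have hn : (n ! : ℂ) ≠ 0 := by exact_mod_cast n.factorial_ne_zero
  have hn1 : (n : ℂ) + 1 ≠ 0 := by exact_mod_cast n.succ_ne_zero
  have hn2 : (n : ℂ) + 1 + 1 ≠ 0 := by exact_mod_cast (n + 1).succ_ne_zero
  have hzero : ((n : ℂ) + 2) * ((2 * z) ^ (n + 2) / ((n + 2)! : ℂ)) =
      2 * z * ((2 * z) ^ (n + 1) / ((n + 1)! : ℂ)) := by
    simp only [Nat.factorial_succ]
    push_cast
    field_simp
    ring
  simp only [mul_zero, zero_le, if_true, pow_zero, Nat.sub_zero, Nat.factorial_zero, one_mul,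
    Nat.cast_one]
  rw [show ((n + 2)! : ℂ) = (n + 2) * ((n + 1) * (n ! : ℂ)) by
      rw [Nat.factorial_succ, Nat.factorial_succ]; push_cast; ring,
    show ((n + 1)! : ℂ) = (n + 1) * (n ! : ℂ) by rw [Nat.factorial_succ]; push_cast; ring]
    at hzero ⊢
  linear_combination ((n : ℂ) + 1) * n ! * (hsum + hzero)

/-- The Taylor series at `0` of a complex function, as a formal power series. -/
noncomputable def taylorPowerSeries (f : ℂ → ℂ) : PowerSeries ℂ :=
  PowerSeries.mk fun n => iteratedDeriv n f 0 / n !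

namespace taylorPowerSeries

theorem coeff_eq (f : ℂ → ℂ) (n : ℕ) :
    PowerSeries.coeff n (taylorPowerSeries f) = iteratedDeriv n f 0 / n ! :=
  PowerSeries.coeff_mk _ _

theorem congr {f g : ℂ → ℂ} (h : f =ᶠ[nhds 0] g) : taylorPowerSeries f = taylorPowerSeries g := by
  ext n
  rw [coeff_eq, coeff_eq, h.iteratedDeriv_eq]

theorem deriv_eq (f : ℂ → ℂ) :
    taylorPowerSeries (deriv f) = PowerSeries.derivative ℂ (taylorPowerSeries f) := by
  ext n
  have hn : (n ! : ℂ) ≠ 0 := by exact_mod_cast n.factorial_ne_zero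
  have hn1 : (n : ℂ) + 1 ≠ 0 := by exact_mod_cast n.succ_ne_zero
  rw [PowerSeries.coeff_derivative, coeff_eq, coeff_eq, iteratedDeriv_succ', Nat.factorial_succ]
  push_cast
  field_simp

theorem const_eq (c : ℂ) : taylorPowerSeries (fun _ => c) = PowerSeries.C c := by
  ext n
  rw [coeff_eq, iteratedDeriv_const, PowerSeries.coeff_C]
  split_ifs with h <;> simp [h]

theorem fun_id_eq : taylorPowerSeries (fun x => x) = PowerSeries.X := by
  ext n
  rw [coeff_eq, PowerSeries.coeff_X]
  rcases n with _ | n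
  · simp
  · rw [iteratedDeriv_succ', deriv_id'', iteratedDeriv_const]
    rcases n with _ | n <;> simp

theorem add_eq {f g : ℂ → ℂ} (hf : AnalyticAt ℂ f 0) (hg : AnalyticAt ℂ g 0) :
    taylorPowerSeries (fun x => f x + g x) = taylorPowerSeries f + taylorPowerSeries g := by
  ext n
  rw [map_add, coeff_eq, coeff_eq, coeff_eq, iteratedDeriv_fun_add hf.contDiffAt hg.contDiffAt,
    add_div]

theorem mul_eq {f g : ℂ → ℂ} (hf : AnalyticAt ℂ f 0) (hg : AnalyticAt ℂ g 0) :
    taylorPowerSeries (fun x => f x * g x) = taylorPowerSeries f * taylorPowerSeries g := by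
  ext n
  rw [PowerSeries.coeff_mul, coeff_eq, iteratedDeriv_fun_mul hf.contDiffAt hg.contDiffAt,
    Finset.Nat.sum_antidiagonal_eq_sum_range_succ_mk, Finset.sum_div]
  refine Finset.sum_congr rfl fun i hi => ?_
  have hi' : i ≤ n := Nat.lt_succ_iff.mp (Finset.mem_range.mp hi)
  have h0 : (n ! : ℂ) ≠ 0 := by exact_mod_cast n.factorial_ne_zero
  have h1 : (i ! : ℂ) ≠ 0 := by exact_mod_cast i.factorial_ne_zero
  have h2 : ((n - i)! : ℂ) ≠ 0 := by exact_mod_cast (n - i).factorial_ne_zero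
  rw [coeff_eq, coeff_eq, Nat.cast_choose ℂ hi']
  field_simp

end taylorPowerSeries

/-- The formal first-order linear differential equation satisfied by the Mehler kernel determines
its coefficients up to the constant term. -/
theorem coeff_eq_of_mehler_ode {x y : ℂ} {p : PowerSeries ℂ} (hp0 : PowerSeries.coeff 0 p = 1)
    (hp : PowerSeries.derivative ℂ p = PowerSeries.C (2 * x * y) * p +
      PowerSeries.X * (PowerSeries.C (1 - 2 * (x ^ 2 + y ^ 2)) * p +
        PowerSeries.X * (PowerSeries.C 2 * PowerSeries.derivative ℂ p +
          PowerSeries.C (2 * x * y) * p + PowerSeries.X * (PowerSeries.C (-1) * p +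
            PowerSeries.C (-1) * (PowerSeries.X * PowerSeries.derivative ℂ p))))) (n : ℕ) :
    PowerSeries.coeff n p = hermiteH n x * hermiteH n y / (2 ^ n * n !) := by
  have h (k : ℕ) := congrArg (PowerSeries.coeff k) hp
  induction n using Nat.strong_induction_on with
  | _ n ih =>
    match n with
    | 0 => simp [hp0, hermiteH_zero]
    | 1 =>
      have h0 := h 0
      simp only [map_add, PowerSeries.coeff_C_mul, PowerSeries.coeff_zero_X_mul,
        PowerSeries.coeff_derivative, hp0] at h0
      norm_num at h0
      rw [h0]
      simp [hermiteH_one]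
      ring
    | 2 =>
      have h0 := h 1
      simp only [map_add, PowerSeries.coeff_C_mul, PowerSeries.coeff_succ_X_mul,
        PowerSeries.coeff_zero_X_mul, PowerSeries.coeff_derivative, hp0, ih 1 (by omega)] at h0
      norm_num at h0
      simp only [hermiteH_add_two, hermiteH_one, hermiteH_zero] at h0 ⊢
      norm_num [Nat.factorial, hermiteH_one] at h0 ⊢
      linear_combination h0 / 2
    | 3 =>
      have h0 := h 2
      simp only [map_add, PowerSeries.coeff_C_mul, PowerSeries.coeff_succ_X_mul,
        PowerSeries.coeff_zero_X_mul, PowerSeries.coeff_derivative, hp0, ih 1 (by omega),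
        ih 2 (by omega)] at h0
      norm_num at h0
      simp only [hermiteH_add_two, hermiteH_one, hermiteH_zero] at h0 ⊢
      norm_num [Nat.factorial, hermiteH_one] at h0 ⊢
      linear_combination h0 / 3
    | 4 =>
      have h0 := h 3
      simp only [map_add, PowerSeries.coeff_C_mul, PowerSeries.coeff_succ_X_mul,
        PowerSeries.coeff_zero_X_mul, PowerSeries.coeff_derivative, hp0, ih 1 (by omega),
        ih 2 (by omega), ih 3 (by omega)] at h0
      norm_num at h0
      simp only [hermiteH_add_two, hermiteH_one, hermiteH_zero] at h0 ⊢
      norm_num [Nat.factorial, hermiteH_one] at h0 ⊢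
      linear_combination h0 / 4
    | n + 5 =>
      have h0 := h (n + 4)
      simp only [map_add, PowerSeries.coeff_C_mul, PowerSeries.coeff_succ_X_mul,
        PowerSeries.coeff_derivative, ih (n + 1) (by omega),
        ih (n + 2) (by omega), ih (n + 3) (by omega), ih (n + 4) (by omega)] at h0
      have hn : (n ! : ℂ) ≠ 0 := by exact_mod_cast n.factorial_ne_zero
      have hn1 : (n : ℂ) + 1 ≠ 0 := by exact_mod_cast n.succ_ne_zero
      have hn2 : (n : ℂ) + 2 ≠ 0 := by exact_mod_cast (n + 1).succ_ne_zero
      have hn3 : (n : ℂ) + 3 ≠ 0 := by exact_mod_cast (n + 2).succ_ne_zero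
      have hn4 : (n : ℂ) + 4 ≠ 0 := by exact_mod_cast (n + 3).succ_ne_zero
      have hn5 : (n : ℂ) + 5 ≠ 0 := by exact_mod_cast (n + 4).succ_ne_zero
      have hn5' : ((n + 4 : ℕ) : ℂ) + 1 ≠ 0 := by exact_mod_cast (n + 4).succ_ne_zero
      apply mul_right_cancel₀ hn5'
      rw [h0]
      have fac (k : ℕ) : ((n + (k + 1))! : ℂ) = (n + (k + 1)) * (n + k)! := by
        rw [← add_assoc, Nat.factorial_succ]
        push_cast
        ring
      have fac1 := fac 0
      have fac2 := fac 1
      have fac3 := fac 2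
      have fac4 := fac 3
      have fac5 := fac 4
      norm_num at fac1 fac2 fac3 fac4 fac5
      rw [fac5, fac4, fac3, fac2, fac1, show ((n + 4 : ℕ) : ℂ) + 1 = n + 5 by push_cast; ring,
        show ((n + 2 : ℕ) : ℂ) + 1 = n + 3 by push_cast; ring]
      simp only [pow_add]
      field_simp
      simp only [hermiteH_add_two]
      push_cast
      ring

/-- The closed form of Mehler's formula, as a function of a complex parameter. -/
noncomputable def mehlerKernel (x y w : ℂ) : ℂ :=
  Complex.exp (-(1 / 2) * Complex.log (1 - w ^ 2) +
    (2 * w * x * y - w ^ 2 * (x ^ 2 + y ^ 2)) / (1 - w ^ 2))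

theorem one_sub_sq_mem_slitPlane {w : ℂ} (hw : ‖w‖ < 1) : 1 - w ^ 2 ∈ Complex.slitPlane := by
  rw [sub_eq_add_neg]
  apply Complex.mem_slitPlane_of_norm_lt_one
  rw [norm_neg, norm_pow]
  exact pow_lt_one₀ (norm_nonneg w) hw two_ne_zero

theorem hasDerivAt_mehlerKernel (x y : ℂ) {w : ℂ} (hw : ‖w‖ < 1) :
    HasDerivAt (mehlerKernel x y) (mehlerKernel x y w *
      ((w * (1 - w ^ 2) + 2 * x * y * (1 + w ^ 2) - 2 * w * (x ^ 2 + y ^ 2)) /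
        (1 - w ^ 2) ^ 2)) w := by
  have hs := one_sub_sq_mem_slitPlane hw
  have hne := Complex.slitPlane_ne_zero hs
  have hsq : HasDerivAt (fun w : ℂ => w ^ 2) (2 * w) w := by simpa using hasDerivAt_pow 2 w
  have hden : HasDerivAt (fun w : ℂ => 1 - w ^ 2) (-(2 * w)) w := hsq.const_sub 1
  have hnum : HasDerivAt (fun w : ℂ => 2 * w * x * y - w ^ 2 * (x ^ 2 + y ^ 2))
      (2 * 1 * x * y - 2 * w * (x ^ 2 + y ^ 2)) w :=
    ((((hasDerivAt_id w).const_mul 2).mul_const x).mul_const y).sub (hsq.mul_const _)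
  refine (((hden.clog hs).const_mul (-(1 / 2))).add (hnum.div hden hne)).cexp.congr_deriv ?_
  change Complex.exp _ * _ = Complex.exp _ * _
  congr 1
  field_simp
  ring

theorem differentiableOn_mehlerKernel (x y : ℂ) :
    DifferentiableOn ℂ (mehlerKernel x y) (Metric.ball 0 1) := fun _ hw =>
  (hasDerivAt_mehlerKernel x y (mem_ball_zero_iff.mp hw)).differentiableAt.differentiableWithinAt

theorem coeff_taylorPowerSeries_mehlerKernel (x y : ℂ) (n : ℕ) :
    PowerSeries.coeff n (taylorPowerSeries (mehlerKernel x y)) =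
      hermiteH n x * hermiteH n y / (2 ^ n * n !) := by
  have hball : Metric.ball (0 : ℂ) 1 ∈ nhds 0 := Metric.ball_mem_nhds 0 one_pos
  have hf : AnalyticAt ℂ (mehlerKernel x y) 0 :=
    (differentiableOn_mehlerKernel x y).analyticAt hball
  have hf' : AnalyticAt ℂ (deriv (mehlerKernel x y)) 0 := hf.deriv
  apply coeff_eq_of_mehler_ode
  · simp [taylorPowerSeries.coeff_eq, mehlerKernel]
  · have hode : deriv (mehlerKernel x y) =ᶠ[nhds 0] fun w => 2 * x * y * mehlerKernel x y w +
        w * ((1 - 2 * (x ^ 2 + y ^ 2)) * mehlerKernel x y w +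
          w * (2 * deriv (mehlerKernel x y) w + 2 * x * y * mehlerKernel x y w +
            w * ((-1) * mehlerKernel x y w + (-1) * (w * deriv (mehlerKernel x y) w)))) := by
      filter_upwards [hball] with w hw
      have hw := mem_ball_zero_iff.mp hw
      have hne := Complex.slitPlane_ne_zero (one_sub_sq_mem_slitPlane hw)
      rw [(hasDerivAt_mehlerKernel x y hw).deriv]
      field_simp
      ring
    have hT := taylorPowerSeries.congr hode
    rw [← taylorPowerSeries.deriv_eq]
    generalize deriv (mehlerKernel x y) = g at hf' hT ⊢
    generalize mehlerKernel x y = f at hf hT ⊢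
    generalize 2 * x * y = a at hT ⊢
    generalize 1 - 2 * (x ^ 2 + y ^ 2) = b at hT ⊢
    refine hT.trans ?_
    open taylorPowerSeries in
    rw [add_eq, mul_eq, mul_eq, add_eq, mul_eq, mul_eq, add_eq, add_eq, mul_eq, mul_eq, mul_eq,
      add_eq, mul_eq, mul_eq, mul_eq, fun_id_eq, const_eq, const_eq, const_eq, const_eq] <;> fun_prop

theorem mehlerKernel_ofReal (x y : ℂ) {t : ℝ} (ht : |t| < 1) :
    mehlerKernel x y t = (1 / (Real.sqrt (1 - t ^ 2) : ℂ)) *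
      Complex.exp ((2 * (t : ℂ) * x * y - (t : ℂ) ^ 2 * (x ^ 2 + y ^ 2)) / (1 - (t : ℂ) ^ 2)) := by
  have hpos : 0 < 1 - t ^ 2 := sub_pos.mpr ((sq_lt_one_iff_abs_lt_one t).mpr ht)
  rw [mehlerKernel, Complex.exp_add]
  congr 1
  rw [show 1 - (t : ℂ) ^ 2 = ((1 - t ^ 2 : ℝ) : ℂ) by push_cast; rfl,
    ← Complex.ofReal_log hpos.le, Real.sqrt_eq_rpow, Real.rpow_def_of_pos hpos, Complex.ofReal_exp,
    one_div (Complex.exp _), ← Complex.exp_neg]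
  congr 1
  push_cast
  ring

/-- Mehler's formula: for all `z₁ z₂ ∈ ℂ` and real `t` with `|t| < 1`,
`∑_{l=0}^{∞} t^l/(2^l l!) · H_l(z₁) H_l(z₂)
  = (1−t²)^{−1/2} exp[(2t z₁ z₂ − t²(z₁² + z₂²))/(1−t²)]`. -/
theorem mehler_formula (z₁ z₂ : ℂ) (t : ℝ) (ht : |t| < 1) :
    HasSum (fun l : ℕ => (t : ℂ) ^ l / (2 ^ l * (l ! : ℂ)) * hermiteH l z₁ * hermiteH l z₂)
      ((1 / (Real.sqrt (1 - t ^ 2) : ℂ)) *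
        Complex.exp ((2 * (t : ℂ) * z₁ * z₂ - (t : ℂ) ^ 2 * (z₁ ^ 2 + z₂ ^ 2)) /
          (1 - (t : ℂ) ^ 2))) := by
  have hmem : (t : ℂ) ∈ Metric.ball (0 : ℂ) 1 := by
    rwa [mem_ball_zero_iff, Complex.norm_real, Real.norm_eq_abs]
  have hsum := Complex.hasSum_taylorSeries_on_ball
    (differentiableOn_mehlerKernel z₁ z₂) hmem
  rw [mehlerKernel_ofReal z₁ z₂ ht] at hsum
  refine hsum.congr_fun fun l => ?_
  have hl := coeff_taylorPowerSeries_mehlerKernel z₁ z₂ l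
  rw [taylorPowerSeries.coeff_eq] at hl
  simp only [smul_eq_mul, sub_zero]
  linear_combination -(t : ℂ) ^ l * hl
end

section
/- For all complex numbers z₁, z₂, all real u, v, and all real s, t with |st| < 1, the double series ∑_{m=0}^{∞} ∑_{n=0}^{∞} s^m t^n/(√(2^{m+n}) m! n!) · H_{m,n}(z₁,z₂) H_m(u) H_n(v) converges and equals (1−s²t²)^{−1/2} · exp[(2√2(s u z₁ + t v z₂ + s t (s v z₁ + t u z₂)) − s² z₁² − t² z₂² − 4 s t u v − 2 s² t² (z₁ z₂ + u² + v²)) / (2(1−s²t²))]. -/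
open Finset
open scoped Nat

/-- The complex Hermite polynomial
`H_{m,n}(z₁,z₂) = ∑_{k=0}^{min(m,n)} C(m,k) C(n,k) (−1)^k k! z₁^{m−k} z₂^{n−k}`. -/
noncomputable def complexHermite (m n : ℕ) (z₁ z₂ : ℂ) : ℂ :=
  ∑ k ∈ Finset.range (min m n + 1),
    (m.choose k : ℂ) * (n.choose k : ℂ) * (-1 : ℂ) ^ k * (k ! : ℂ) *
      z₁ ^ (m - k) * z₂ ^ (n - k)

/-- The polynomial `∑ k, C(m,k) C(n,k) c^k k! x^(m-k) y^(n-k)`, which is `H_{m,n}(x,y)` for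
`c = -1`. -/
def complexHermiteAux {R : Type*} [CommSemiring R] (c : R) (m n : ℕ) (x y : R) : R :=
  ∑ k ∈ Finset.range (min m n + 1),
    (m.choose k : R) * (n.choose k : R) * c ^ k * (k ! : R) * x ^ (m - k) * y ^ (n - k)

lemma hasSum_complexHermiteAux {𝕜 : Type*} [RCLike 𝕜] (c x y ξ η : 𝕜) :
    HasSum (fun p : ℕ × ℕ => complexHermiteAux c p.1 p.2 x y * ξ ^ p.1 * η ^ p.2 /
      ((p.1 ! : 𝕜) * (p.2 ! : 𝕜))) (NormedSpace.exp (x * ξ + y * η + c * (ξ * η))) := by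
  set g : (ℕ × ℕ) × ℕ → 𝕜 := fun q =>
    (q.1.1.choose q.2 : 𝕜) * (q.1.2.choose q.2 : 𝕜) * c ^ q.2 * (q.2 ! : 𝕜) *
      x ^ (q.1.1 - q.2) * y ^ (q.1.2 - q.2) * ξ ^ q.1.1 * η ^ q.1.2 /
      ((q.1.1 ! : 𝕜) * (q.1.2 ! : 𝕜)) with hg
  set i : (ℕ × ℕ) × ℕ → (ℕ × ℕ) × ℕ := fun q => ((q.1.1 + q.2, q.1.2 + q.2), q.2) with hi
  have hinj : Function.Injective i := by
    rintro ⟨⟨a, b⟩, k⟩ ⟨⟨a', b'⟩, k'⟩ h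
    simp only [hi, Prod.mk.injEq] at h
    simp only [Prod.mk.injEq]
    lia
  have hzero : ∀ q ∉ Set.range i, g q = 0 := by
    rintro ⟨⟨m, n⟩, k⟩ hq
    have : m < k ∨ n < k := by
      by_contra! h
      exact hq ⟨((m - k, n - k), k), by simp [hi, h.1, h.2]⟩
    rcases this with h | h <;> simp [hg, Nat.choose_eq_zero_of_lt h]
  let e (z : 𝕜) (n : ℕ) : 𝕜 := z ^ n / (n ! : 𝕜)
  have hnorm (z : 𝕜) : Summable fun n => ‖e z n‖ := NormedSpace.norm_expSeries_div_summable z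
  have hexp (z : 𝕜) : HasSum (e z) (NormedSpace.exp z) := NormedSpace.expSeries_div_hasSum_exp z
  have hn₁ : Summable fun q : ℕ × ℕ => ‖e (x * ξ) q.1 * e (y * η) q.2‖ :=
    (hnorm (x * ξ)).mul_norm (hnorm (y * η))
  have h₁ : HasSum (fun q : ℕ × ℕ => e (x * ξ) q.1 * e (y * η) q.2)
      (NormedSpace.exp (x * ξ) * NormedSpace.exp (y * η)) :=
    (hexp (x * ξ)).mul (hexp (y * η)) hn₁.of_norm
  have h₂ := h₁.mul (hexp (c * (ξ * η))) (hn₁.mul_norm (hnorm (c * (ξ * η)))).of_norm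
  have hcomp : HasSum (g ∘ i) (NormedSpace.exp (x * ξ + y * η + c * (ξ * η))) := by
    have heq : g ∘ i = fun q => e (x * ξ) q.1.1 * e (y * η) q.1.2 * e (c * (ξ * η)) q.2 := by
      funext q
      obtain ⟨⟨a, b⟩, k⟩ := q
      have hc (a : ℕ) : ((a + k).choose k : 𝕜) = ((a + k)! : 𝕜) / ((a ! : 𝕜) * (k ! : 𝕜)) := by
        rw [Nat.cast_choose 𝕜 (Nat.le_add_left k a), Nat.add_sub_cancel, mul_comm]
      have hf (a : ℕ) : (a ! : 𝕜) ≠ 0 := Nat.cast_ne_zero.2 a.factorial_ne_zero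
      simp only [e, hg, hi, Function.comp, hc, Nat.add_sub_cancel]
      have := hf a
      have := hf b
      have := hf k
      have := hf (a + k)
      have := hf (b + k)
      field_simp
      ring
    rw [heq, NormedSpace.exp_add, NormedSpace.exp_add]
    exact h₂
  have hsum := (hinj.hasSum_iff hzero).1 hcomp
  refine HasSum.prod_fiberwise hsum fun p => ?_
  have : complexHermiteAux c p.1 p.2 x y * ξ ^ p.1 * η ^ p.2 / ((p.1 ! : 𝕜) * (p.2 ! : 𝕜)) =
      ∑ k ∈ Finset.range (min p.1 p.2 + 1), g (p, k) := by
    simp only [complexHermiteAux, hg, Finset.sum_mul, Finset.sum_div]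
  rw [this]
  refine hasSum_sum_of_ne_finset_zero fun k hk => ?_
  have : p.1 < k ∨ p.2 < k := by
    simp only [Finset.mem_range] at hk
    lia
  rcases this with h | h <;> simp [hg, Nat.choose_eq_zero_of_lt h]

lemma norm_complexHermiteAux_le {𝕜 : Type*} [RCLike 𝕜] (c : 𝕜) (m n : ℕ) (x y : 𝕜) :
    ‖complexHermiteAux c m n x y‖ ≤ complexHermiteAux ‖c‖ m n ‖x‖ ‖y‖ := by
  refine (norm_sum_le _ _).trans_eq (Finset.sum_congr rfl fun k _ => ?_)
  simp

lemma integral_pow_mul_exp_neg_sq_odd {j : ℕ} (hj : Odd j) :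
    ∫ x : ℝ, x ^ j * Real.exp (-x ^ 2) = 0 := by
  have h := MeasureTheory.integral_neg_eq_self (fun x : ℝ => x ^ j * Real.exp (-x ^ 2))
    MeasureTheory.volume
  simp only [hj.neg_pow, neg_sq, neg_mul, MeasureTheory.integral_neg] at h
  linarith

lemma integral_pow_mul_exp_neg_sq_even (m : ℕ) :
    ∫ x : ℝ, x ^ (2 * m) * Real.exp (-x ^ 2) =
      Real.sqrt Real.pi * ((2 * m)! : ℝ) / (4 ^ m * (m ! : ℝ)) := by
  have h₁ := integral_comp_abs (f := fun x : ℝ => x ^ (2 * m) * Real.exp (-x ^ 2))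
  have h₂ := integral_rpow_mul_exp_neg_rpow (p := 2) (q := ((2 * m : ℕ) : ℝ)) two_pos
    (neg_one_lt_zero.trans_le (Nat.cast_nonneg _))
  simp only [Real.rpow_natCast, Real.rpow_two] at h₂
  have h₃ : (((2 * m : ℕ) : ℝ) + 1) / 2 = m + 1 / 2 := by push_cast; ring
  simp only [pow_mul, sq_abs] at h₁ h₂ ⊢
  rw [h₁, h₂, h₃, Real.Gamma_nat_add_half]
  have h₄ : ((2 * m)! : ℝ) = 2 ^ m * (m ! : ℝ) * ((2 * m - 1 : ℕ)‼ : ℝ) := by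
    rcases m with _ | m
    · simp
    · have := Nat.factorial_eq_mul_doubleFactorial (2 * m + 1)
      rw [show 2 * m + 1 + 1 = 2 * (m + 1) by ring, Nat.doubleFactorial_two_mul] at this
      rw [this, show 2 * (m + 1) - 1 = 2 * m + 1 by lia]
      push_cast
      ring
  rw [h₄, show (4 : ℝ) ^ m = 2 ^ m * 2 ^ m by rw [← mul_pow]; norm_num]
  have : (m ! : ℝ) ≠ 0 := Nat.cast_ne_zero.2 m.factorial_ne_zero
  field_simp

lemma integrable_pow_mul_exp_neg_sq (j : ℕ) :
    MeasureTheory.Integrable fun x : ℝ => x ^ j * Real.exp (-x ^ 2) := by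
  have := integrable_rpow_mul_exp_neg_mul_sq one_pos
    (neg_one_lt_zero.trans_le (Nat.cast_nonneg (α := ℝ) j))
  simpa using this

/-- The integral representation `H_n(z) = π^{-1/2} ∫ (2 (z + i x))^n e^{-x²} dx`. -/
lemma integral_add_mul_I_pow_mul_exp_neg_sq (n : ℕ) (z : ℂ) :
    ∫ x : ℝ, (2 * (z + x * Complex.I)) ^ n * (Real.exp (-x ^ 2) : ℂ) =
      (Real.sqrt Real.pi : ℂ) * hermiteH n z := by
  have hexpand (x : ℝ) : (2 * (z + x * Complex.I)) ^ n * (Real.exp (-x ^ 2) : ℂ) =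
      ∑ j ∈ Finset.range (n + 1), (2 ^ n * Complex.I ^ j * z ^ (n - j) * (n.choose j : ℂ)) *
        ((x ^ j * Real.exp (-x ^ 2) : ℝ) : ℂ) := by
    rw [mul_pow, add_comm z, add_pow, Finset.mul_sum, Finset.sum_mul]
    refine Finset.sum_congr rfl fun j _ => ?_
    push_cast
    ring
  simp_rw [hexpand]
  rw [MeasureTheory.integral_finsetSum _ fun j _ =>
    (integrable_pow_mul_exp_neg_sq j).ofReal.const_mul _]
  simp_rw [MeasureTheory.integral_const_mul, integral_complex_ofReal]
  rw [hermiteH, Finset.mul_sum, Finset.mul_sum]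
  symm
  refine Finset.sum_of_injOn (fun m => 2 * m) (fun a _ b _ h => by simpa using h) ?_ ?_ ?_
  · intro m hm
    simp only [Finset.coe_range, Set.mem_Iio] at hm ⊢
    lia
  · intro j hj hj'
    have hodd : Odd j := by
      rw [← Nat.not_even_iff_odd]
      rintro ⟨m, rfl⟩
      refine hj' ⟨m, ?_, by simp [two_mul]⟩
      simp only [Finset.coe_range, Finset.mem_range, Set.mem_Iio] at hj ⊢
      lia
    simp [integral_pow_mul_exp_neg_sq_odd hodd]
  · intro m hm
    have hmn : 2 * m ≤ n := by
      simp only [Finset.mem_range] at hm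
      lia
    rw [integral_pow_mul_exp_neg_sq_even, Nat.cast_choose ℂ hmn, pow_mul, Complex.I_sq, mul_pow]
    have hf (a : ℕ) : (a ! : ℂ) ≠ 0 := Nat.cast_ne_zero.2 a.factorial_ne_zero
    have := hf m
    have := hf (2 * m)
    have := hf (n - 2 * m)
    have h4 : (2 : ℂ) ^ n = 2 ^ (n - 2 * m) * 4 ^ m := by
      rw [show (4 : ℂ) = 2 ^ 2 by norm_num, ← pow_mul, ← pow_add, Nat.sub_add_cancel hmn]
    rw [h4]
    push_cast
    field_simp

lemma integrable_exp_abs_mul_exp_neg_sq {r : ℝ} (hr : r < 1) (A B C : ℝ) :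
    MeasureTheory.Integrable fun q : ℝ × ℝ =>
      Real.exp (A * |q.1| + B * |q.2| + C + 2 * r * (|q.1| * |q.2|)) *
        (Real.exp (-q.1 ^ 2) * Real.exp (-q.2 ^ 2)) := by
  obtain ⟨ε, hε, hεr⟩ : ∃ ε > 0, ∀ x y : ℝ, 0 ≤ x → 0 ≤ y →
      2 * r * (x * y) ≤ (1 - 2 * ε) * (x ^ 2 + y ^ 2) := by
    refine ⟨min ((1 - r) / 2) (1 / 2), lt_min (by linarith) (by norm_num), fun x y hx hy => ?_⟩
    rcases min_cases ((1 - r) / 2) (1 / 2 : ℝ) with ⟨h, h'⟩ | ⟨h, h'⟩ <;> rw [h]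
    · nlinarith [mul_nonneg (by linarith : 0 ≤ r) (sq_nonneg (x - y))]
    · nlinarith [mul_nonneg (by linarith : 0 ≤ -r) (mul_nonneg hx hy)]
  have hdom := ((integrable_exp_neg_mul_sq hε).mul_prod (integrable_exp_neg_mul_sq hε)).const_mul
    (Real.exp (C + A ^ 2 / (4 * ε) + B ^ 2 / (4 * ε)))
  refine hdom.mono' (by fun_prop) (Filter.Eventually.of_forall fun ⟨x, y⟩ => ?_)
  have key (D w : ℝ) : D * |w| ≤ ε * w ^ 2 + D ^ 2 / (4 * ε) := by
    have : ε * w ^ 2 + D ^ 2 / (4 * ε) - D * |w| = (2 * ε * |w| - D) ^ 2 / (4 * ε) := by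
      field_simp
      rw [← sq_abs w]
      ring
    have : 0 ≤ (2 * ε * |w| - D) ^ 2 / (4 * ε) := by positivity
    linarith
  have h := hεr |x| |y| (abs_nonneg x) (abs_nonneg y)
  simp only [sq_abs] at h
  simp only [← Real.exp_add, Real.norm_eq_abs, Real.abs_exp, Real.exp_le_exp]
  nlinarith [key A x, key B y]

/-- The two-dimensional Gaussian integral with a cross term. -/
lemma integral_cexp_quadratic_prod {r : ℝ} (hr : |r| < 1) (a b c : ℂ) :
    ∫ q : ℝ × ℝ, Complex.exp (a * q.1 + b * q.2 + c + 2 * r * (q.1 * q.2)) *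
        ((Real.exp (-q.1 ^ 2) * Real.exp (-q.2 ^ 2) : ℝ) : ℂ) =
      Real.pi * (1 / (Real.sqrt (1 - r ^ 2) : ℂ)) *
        Complex.exp (c + (a ^ 2 + b ^ 2 + 2 * r * a * b) / (4 * (1 - (r : ℂ) ^ 2))) := by
  have hr' : 0 < 1 - r ^ 2 := by
    have := (sq_lt_one_iff_abs_lt_one r).2 hr
    linarith
  have hint : MeasureTheory.Integrable fun q : ℝ × ℝ =>
      Complex.exp (a * q.1 + b * q.2 + c + 2 * r * (q.1 * q.2)) *
        ((Real.exp (-q.1 ^ 2) * Real.exp (-q.2 ^ 2) : ℝ) : ℂ) := by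
    refine (integrable_exp_abs_mul_exp_neg_sq hr ‖a‖ ‖b‖ ‖c‖).mono' (by fun_prop)
      (Filter.Eventually.of_forall fun ⟨x, y⟩ => ?_)
    rw [norm_mul, Complex.norm_real, Real.norm_of_nonneg (by positivity)]
    gcongr
    refine (Complex.norm_exp_le_exp_norm _).trans (Real.exp_le_exp.2 ?_)
    exact norm_add₄_le.trans_eq (by simp)
  have hinner (x : ℝ) : ∫ y : ℝ, Complex.exp (a * x + b * y + c + 2 * r * (x * y)) *
      ((Real.exp (-x ^ 2) * Real.exp (-y ^ 2) : ℝ) : ℂ) =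
      (Real.sqrt Real.pi : ℂ) * Complex.exp
        ((-(1 - r ^ 2 : ℝ) : ℂ) * x ^ 2 + (a + r * b) * x + (c + b ^ 2 / 4)) := by
    have h := integral_cexp_quadratic (b := -1) (by simp) (b + 2 * r * x) (a * x + c - x ^ 2)
    rw [neg_neg, div_one] at h
    rw [Real.sqrt_eq_rpow, Complex.ofReal_cpow Real.pi_nonneg]
    convert h using 2
    · ext y
      push_cast
      rw [← Complex.exp_add, ← Complex.exp_add]
      congr 1
      ring
    · norm_num
    · congr 1
      push_cast
      ring
  rw [MeasureTheory.Measure.volume_eq_prod, MeasureTheory.integral_prod _ hint]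
  simp only [hinner, MeasureTheory.integral_const_mul]
  rw [integral_cexp_quadratic (by rw [← Complex.ofReal_neg, Complex.ofReal_re]; linarith)]
  rw [neg_neg, ← Complex.ofReal_div, show (1 / 2 : ℂ) = ((1 / 2 : ℝ) : ℂ) by norm_num,
    ← Complex.ofReal_cpow (by positivity), ← Real.sqrt_eq_rpow, Real.sqrt_div Real.pi_nonneg,
    ← mul_assoc]
  have hne : (1 - (r : ℂ) ^ 2) ≠ 0 := by exact_mod_cast hr'.ne'
  congr 1
  · rw [← Complex.ofReal_mul, ← mul_div_assoc, Real.mul_self_sqrt Real.pi_nonneg]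
    push_cast
    ring
  · congr 1
    push_cast
    field_simp
    ring

lemma norm_ofReal_add_mul_I_le (w x : ℝ) : ‖(w : ℂ) + x * Complex.I‖ ≤ |w| + |x| :=
  (norm_add_le _ _).trans_eq (by simp)

/-- The summands of the series as Gaussian integrals, with `ξ = √2 s (u + i x)` and
`η = √2 t (v + i y)`. -/
lemma integral_complexHermiteAux_mul_exp_neg_sq (z₁ z₂ : ℂ) (u v s t : ℝ) (m n : ℕ) :
    ∫ q : ℝ × ℝ, (complexHermiteAux (-1) m n z₁ z₂ *
        ((Real.sqrt 2 * s : ℝ) * (u + q.1 * Complex.I)) ^ m *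
        ((Real.sqrt 2 * t : ℝ) * (v + q.2 * Complex.I)) ^ n / ((m ! : ℂ) * (n ! : ℂ))) *
        ((Real.exp (-q.1 ^ 2) * Real.exp (-q.2 ^ 2) : ℝ) : ℂ) =
      Real.pi * ((s : ℂ) ^ m * (t : ℂ) ^ n /
          ((Real.sqrt (2 ^ (m + n)) : ℂ) * (m ! : ℂ) * (n ! : ℂ)) *
        complexHermite m n z₁ z₂ * hermiteH m (u : ℂ) * hermiteH n (v : ℂ)) := by
  have hsqrt : Real.sqrt (2 ^ (m + n)) = Real.sqrt 2 ^ (m + n) := by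
    rw [Real.sqrt_eq_iff_mul_self_eq (by positivity) (by positivity), ← mul_pow,
      Real.mul_self_sqrt zero_le_two]
  have h2 : ((Real.sqrt 2 : ℝ) : ℂ) ^ 2 = 2 := by
    rw [← Complex.ofReal_pow, Real.sq_sqrt zero_le_two, Complex.ofReal_ofNat]
  have h2' : ((Real.sqrt 2 : ℝ) : ℂ) ≠ 0 := fun h => by simp [h] at h2
  have hπ : ((Real.sqrt Real.pi : ℝ) : ℂ) * Real.sqrt Real.pi = Real.pi := by
    rw [← Complex.ofReal_mul, Real.mul_self_sqrt Real.pi_nonneg]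
  have hsplit (q : ℝ × ℝ) : (complexHermiteAux (-1) m n z₁ z₂ *
        ((Real.sqrt 2 * s : ℝ) * (u + q.1 * Complex.I)) ^ m *
        ((Real.sqrt 2 * t : ℝ) * (v + q.2 * Complex.I)) ^ n / ((m ! : ℂ) * (n ! : ℂ))) *
        ((Real.exp (-q.1 ^ 2) * Real.exp (-q.2 ^ 2) : ℝ) : ℂ) =
      ((s : ℂ) ^ m * (t : ℂ) ^ n / ((Real.sqrt (2 ^ (m + n)) : ℂ) * (m ! : ℂ) * (n ! : ℂ)) *
        complexHermite m n z₁ z₂) *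
      (((2 * (u + q.1 * Complex.I)) ^ m * (Real.exp (-q.1 ^ 2) : ℂ)) *
        ((2 * (v + q.2 * Complex.I)) ^ n * (Real.exp (-q.2 ^ 2) : ℂ))) := by
    have hH : complexHermiteAux (-1) m n z₁ z₂ = complexHermite m n z₁ z₂ := rfl
    rw [hsqrt, hH, ← h2]
    push_cast
    simp only [mul_pow, pow_add, ← pow_mul, mul_comm 2 m, mul_comm 2 n]
    simp only [pow_mul, sq]
    field_simp
  simp_rw [hsplit]
  rw [MeasureTheory.integral_const_mul, MeasureTheory.Measure.volume_eq_prod,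
    MeasureTheory.integral_prod_mul
      (fun x : ℝ => (2 * ((u : ℂ) + x * Complex.I)) ^ m * (Real.exp (-x ^ 2) : ℂ))
      (fun y : ℝ => (2 * ((v : ℂ) + y * Complex.I)) ^ n * (Real.exp (-y ^ 2) : ℂ)),
    integral_add_mul_I_pow_mul_exp_neg_sq, integral_add_mul_I_pow_mul_exp_neg_sq, ← hπ]
  ring

/-- The Mehler-type formula for the product of complex Hermite polynomials of two
complex variables and two Hermite polynomials of one real variable: for `|st| < 1`,
`∑_{m,n} s^m t^n/(√(2^{m+n}) m! n!) H_{m,n}(z₁,z₂) H_m(u) H_n(v)` equals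
`(1−s²t²)^{−1/2} exp[(2√2(suz₁+tvz₂+st(svz₁+tuz₂)) − s²z₁² − t²z₂²
  − 4stuv − 2s²t²(z₁z₂+u²+v²))/(2(1−s²t²))]`. -/
theorem mehler_formula_two_variables (z₁ z₂ : ℂ) (u v : ℝ) (s t : ℝ)
    (hst : |s * t| < 1) :
    HasSum (fun p : ℕ × ℕ =>
      (s : ℂ) ^ p.1 * (t : ℂ) ^ p.2 /
          ((Real.sqrt (2 ^ (p.1 + p.2)) : ℂ) * (p.1 ! : ℂ) * (p.2 ! : ℂ)) *
        complexHermite p.1 p.2 z₁ z₂ * hermiteH p.1 (u : ℂ) * hermiteH p.2 (v : ℂ))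
      ((1 / (Real.sqrt (1 - s ^ 2 * t ^ 2) : ℂ)) *
        Complex.exp
          ((2 * (Real.sqrt 2 : ℂ) *
                ((s : ℂ) * (u : ℂ) * z₁ + (t : ℂ) * (v : ℂ) * z₂ +
                  (s : ℂ) * (t : ℂ) * ((s : ℂ) * (v : ℂ) * z₁ + (t : ℂ) * (u : ℂ) * z₂)) -
              (s : ℂ) ^ 2 * z₁ ^ 2 - (t : ℂ) ^ 2 * z₂ ^ 2 -
              4 * (s : ℂ) * (t : ℂ) * (u : ℂ) * (v : ℂ) -
              2 * (s : ℂ) ^ 2 * (t : ℂ) ^ 2 * (z₁ * z₂ + (u : ℂ) ^ 2 + (v : ℂ) ^ 2)) /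
            (2 * (1 - (s : ℂ) ^ 2 * (t : ℂ) ^ 2)))) := by
  have h2 : Real.sqrt 2 * Real.sqrt 2 = 2 := Real.mul_self_sqrt zero_le_two
  have h2' : (Real.sqrt 2 : ℂ) * (Real.sqrt 2 : ℂ) = 2 := by exact_mod_cast h2
  have hdom : ∀ x y : ℝ, HasSum (fun p : ℕ × ℕ =>
      complexHermiteAux 1 p.1 p.2 ‖z₁‖ ‖z₂‖ * (Real.sqrt 2 * |s| * (|u| + |x|)) ^ p.1 *
        (Real.sqrt 2 * |t| * (|v| + |y|)) ^ p.2 / ((p.1 ! : ℝ) * (p.2 ! : ℝ)) *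
        (Real.exp (-x ^ 2) * Real.exp (-y ^ 2)))
      (Real.exp ((‖z₁‖ * Real.sqrt 2 * |s| + 2 * |s * t| * |v|) * |x| +
        (‖z₂‖ * Real.sqrt 2 * |t| + 2 * |s * t| * |u|) * |y| +
        (‖z₁‖ * Real.sqrt 2 * |s| * |u| + ‖z₂‖ * Real.sqrt 2 * |t| * |v| +
          2 * |s * t| * |u| * |v|) + 2 * |s * t| * (|x| * |y|)) *
        (Real.exp (-x ^ 2) * Real.exp (-y ^ 2))) := by
    intro x y
    refine HasSum.mul_right _ ?_
    convert! hasSum_complexHermiteAux (1 : ℝ) ‖z₁‖ ‖z₂‖ (Real.sqrt 2 * |s| * (|u| + |x|))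
      (Real.sqrt 2 * |t| * (|v| + |y|)) using 1
    rw [← Real.exp_eq_exp_ℝ, abs_mul]
    congr 1
    linear_combination (-|s| * |t| * (|u| + |x|) * (|v| + |y|)) * h2
  have hlim : ∀ x y : ℝ, HasSum (fun p : ℕ × ℕ =>
      (complexHermiteAux (-1) p.1 p.2 z₁ z₂ *
        ((Real.sqrt 2 * s : ℝ) * (u + x * Complex.I)) ^ p.1 *
        ((Real.sqrt 2 * t : ℝ) * (v + y * Complex.I)) ^ p.2 / ((p.1 ! : ℂ) * (p.2 ! : ℂ))) *
        ((Real.exp (-x ^ 2) * Real.exp (-y ^ 2) : ℝ) : ℂ))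
      (Complex.exp ((Complex.I * (Real.sqrt 2 * s * z₁ - 2 * s * t * v)) * x +
        (Complex.I * (Real.sqrt 2 * t * z₂ - 2 * s * t * u)) * y +
        (Real.sqrt 2 * s * u * z₁ + Real.sqrt 2 * t * v * z₂ - 2 * s * t * u * v) +
        2 * (s * t : ℝ) * (x * y)) *
        ((Real.exp (-x ^ 2) * Real.exp (-y ^ 2) : ℝ) : ℂ)) := by
    intro x y
    refine HasSum.mul_right _ ?_
    convert! hasSum_complexHermiteAux (-1 : ℂ) z₁ z₂ ((Real.sqrt 2 * s : ℝ) * (u + x * Complex.I))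
      ((Real.sqrt 2 * t : ℝ) * (v + y * Complex.I)) using 1
    rw [← Complex.exp_eq_exp_ℂ]
    congr 1
    push_cast
    linear_combination (s * t * (u + x * Complex.I) * (v + y * Complex.I)) * h2' +
      (2 * s * t * x * y) * Complex.I_sq
  have hsum := MeasureTheory.hasSum_integral_of_dominated_convergence
    (μ := (MeasureTheory.volume : MeasureTheory.Measure (ℝ × ℝ)))
    (fun (p : ℕ × ℕ) (q : ℝ × ℝ) =>
      complexHermiteAux 1 p.1 p.2 ‖z₁‖ ‖z₂‖ * (Real.sqrt 2 * |s| * (|u| + |q.1|)) ^ p.1 *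
        (Real.sqrt 2 * |t| * (|v| + |q.2|)) ^ p.2 / ((p.1 ! : ℝ) * (p.2 ! : ℝ)) *
        (Real.exp (-q.1 ^ 2) * Real.exp (-q.2 ^ 2)))
    (fun p => by fun_prop)
    (fun p => Filter.Eventually.of_forall fun q => ?_)
    (Filter.Eventually.of_forall fun q => (hdom q.1 q.2).summable)
    (by
      simp_rw [fun q : ℝ × ℝ => (hdom q.1 q.2).tsum_eq]
      exact integrable_exp_abs_mul_exp_neg_sq hst _ _ _)
    (Filter.Eventually.of_forall fun q => hlim q.1 q.2)
  · simp_rw [integral_complexHermiteAux_mul_exp_neg_sq] at hsum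
    rw [integral_cexp_quadratic_prod hst] at hsum
    have hπ : (Real.pi : ℂ) ≠ 0 := Complex.ofReal_ne_zero.2 Real.pi_ne_zero
    rw [mul_assoc, hasSum_mul_left_iff hπ] at hsum
    convert! hsum using 1
    have hne : (1 : ℂ) - (s : ℂ) ^ 2 * (t : ℂ) ^ 2 ≠ 0 := by
      have := (sq_lt_one_iff_abs_lt_one (s * t)).2 hst
      rw [mul_pow] at this
      exact_mod_cast (by linarith : 0 < 1 - s ^ 2 * t ^ 2).ne'
    rw [mul_pow]
    congr 2
    push_cast
    rw [mul_pow (s : ℂ)]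
    field_simp
    have h2sq : (Real.sqrt 2 : ℂ) ^ 2 = 2 := by rw [sq, h2']
    ring_nf
    simp only [Complex.I_sq, h2sq]
    ring
  · rw [norm_mul, Complex.norm_real, Real.norm_of_nonneg (by positivity)]
    refine mul_le_mul_of_nonneg_right ?_ (by positivity)
    have hξ (a w x : ℝ) : ‖((Real.sqrt 2 * a : ℝ) : ℂ) * (w + x * Complex.I)‖ ≤
        Real.sqrt 2 * |a| * (|w| + |x|) := by
      rw [norm_mul, Complex.norm_real, norm_mul, Real.norm_of_nonneg (Real.sqrt_nonneg 2),
        Real.norm_eq_abs]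
      exact mul_le_mul_of_nonneg_left (norm_ofReal_add_mul_I_le w x) (by positivity)
    have hH : ‖complexHermiteAux (-1) p.1 p.2 z₁ z₂‖ ≤ complexHermiteAux 1 p.1 p.2 ‖z₁‖ ‖z₂‖ := by
      simpa using norm_complexHermiteAux_le (-1) p.1 p.2 z₁ z₂
    have hH' : 0 ≤ complexHermiteAux 1 p.1 p.2 ‖z₁‖ ‖z₂‖ := (norm_nonneg _).trans hH
    rw [norm_div, norm_mul, norm_mul, norm_mul, norm_pow, norm_pow, Complex.norm_natCast,
      Complex.norm_natCast]
    gcongr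
    · exact hξ s u q.1
    · exact hξ t v q.2
end

section
/- For all complex numbers s, t, z₁, z₂, the double series ∑_{m=0}^{∞} ∑_{n=0}^{∞} (s^m t^n)/(m! n!) · H_{m,n}(z₁,z₂) converges absolutely and equals exp(s z₁ + t z₂ − s t). -/
open Finset
open scoped Nat

/-- The summand of index `k` in `s ^ m * t ^ n / (m! * n!) * complexHermite m n z₁ z₂`. -/
noncomputable def complexHermiteTerm (s t z₁ z₂ : ℂ) (q : (ℕ × ℕ) × ℕ) : ℂ :=
  s ^ q.1.1 * t ^ q.1.2 / ((q.1.1 ! : ℂ) * (q.1.2 ! : ℂ)) *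
    ((q.1.1.choose q.2 : ℂ) * (q.1.2.choose q.2 : ℂ) * (-1 : ℂ) ^ q.2 * (q.2 ! : ℂ) *
      z₁ ^ (q.1.1 - q.2) * z₂ ^ (q.1.2 - q.2))

theorem complexHermiteTerm_add (s t z₁ z₂ : ℂ) (i j k : ℕ) :
    complexHermiteTerm s t z₁ z₂ ((i + k, j + k), k) =
      (s * z₁) ^ i / (i ! : ℂ) * ((t * z₂) ^ j / (j ! : ℂ)) * ((-(s * t)) ^ k / (k ! : ℂ)) := by
  have hfact (n : ℕ) : (n ! : ℂ) ≠ 0 := Nat.cast_ne_zero.mpr n.factorial_ne_zero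
  simp only [complexHermiteTerm, Nat.add_sub_cancel]
  rw [Nat.cast_choose ℂ (Nat.le_add_left k i), Nat.cast_choose ℂ (Nat.le_add_left k j),
    Nat.add_sub_cancel, Nat.add_sub_cancel, neg_pow (s * t)]
  have hi := hfact i
  have hj := hfact j
  have hk := hfact k
  have hik := hfact (i + k)
  have hjk := hfact (j + k)
  field_simp
  ring

theorem complexHermiteTerm_eq_zero (s t z₁ z₂ : ℂ) {m n k : ℕ} (h : min m n < k) :
    complexHermiteTerm s t z₁ z₂ ((m, n), k) = 0 := by
  rcases min_lt_iff.mp h with h | h <;> simp [complexHermiteTerm, Nat.choose_eq_zero_of_lt h]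

theorem hasSum_complexHermiteTerm_fiber (s t z₁ z₂ : ℂ) (p : ℕ × ℕ) :
    HasSum (fun k => complexHermiteTerm s t z₁ z₂ (p, k))
      (s ^ p.1 * t ^ p.2 / ((p.1 ! : ℂ) * (p.2 ! : ℂ)) * complexHermite p.1 p.2 z₁ z₂) := by
  have h : HasSum (fun k => complexHermiteTerm s t z₁ z₂ (p, k))
      (∑ k ∈ Finset.range (min p.1 p.2 + 1), complexHermiteTerm s t z₁ z₂ (p, k)) :=
    hasSum_sum_of_ne_finset_zero fun k hk =>
      complexHermiteTerm_eq_zero s t z₁ z₂ (by rw [Finset.mem_range] at hk; omega)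
  rw [complexHermite, Finset.mul_sum]
  exact h

theorem HasSum.mul_complex {ι κ : Type*} {f : ι → ℂ} {g : κ → ℂ} {a b : ℂ}
    (hf : HasSum f a) (hg : HasSum g b) :
    HasSum (fun p : ι × κ => f p.1 * g p.2) (a * b) :=
  hf.mul hg (summable_mul_of_summable_norm hf.summable.norm hg.summable.norm)

theorem hasSum_complexHermiteTerm (s t z₁ z₂ : ℂ) :
    HasSum (complexHermiteTerm s t z₁ z₂) (Complex.exp (s * z₁ + t * z₂ - s * t)) := by
  have hexp (z : ℂ) : HasSum (fun n : ℕ => z ^ n / (n ! : ℂ)) (Complex.exp z) := by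
    rw [Complex.exp_eq_exp_ℂ]
    exact NormedSpace.expSeries_div_hasSum_exp z
  have habc := ((hexp (s * z₁)).mul_complex (hexp (t * z₂))).mul_complex (hexp (-(s * t)))
  rw [← Complex.exp_add, ← Complex.exp_add, ← sub_eq_add_neg] at habc
  let shift : (ℕ × ℕ) × ℕ → (ℕ × ℕ) × ℕ := fun q => ((q.1.1 + q.2, q.1.2 + q.2), q.2)
  have hshift : Function.Injective shift := by
    rintro ⟨⟨i, j⟩, k⟩ ⟨⟨i', j'⟩, k'⟩ h
    simp only [shift, Prod.mk.injEq] at h ⊢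
    omega
  rw [← hshift.hasSum_iff]
  · refine habc.congr_fun ?_
    rintro ⟨⟨i, j⟩, k⟩
    exact complexHermiteTerm_add s t z₁ z₂ i j k
  · rintro ⟨⟨m, n⟩, k⟩ hq
    refine complexHermiteTerm_eq_zero s t z₁ z₂ (lt_of_not_ge fun hk => hq ?_)
    rw [le_min_iff] at hk
    exact ⟨((m - k, n - k), k), by simp [shift, hk.1, hk.2]⟩

/-- The generating function of the complex Hermite polynomials: for all
`s t z₁ z₂ ∈ ℂ`, the double series `∑_{m,n} s^m t^n/(m! n!) H_{m,n}(z₁,z₂)`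
converges absolutely and equals `exp(s z₁ + t z₂ − s t)`. -/
theorem complexHermite_generating_function (s t z₁ z₂ : ℂ) :
    (Summable fun p : ℕ × ℕ =>
        ‖s ^ p.1 * t ^ p.2 / ((p.1 ! : ℂ) * (p.2 ! : ℂ)) * complexHermite p.1 p.2 z₁ z₂‖) ∧
    HasSum (fun p : ℕ × ℕ =>
        s ^ p.1 * t ^ p.2 / ((p.1 ! : ℂ) * (p.2 ! : ℂ)) * complexHermite p.1 p.2 z₁ z₂)
      (Complex.exp (s * z₁ + t * z₂ - s * t)) := by
  have h := (hasSum_complexHermiteTerm s t z₁ z₂).prod_fiberwise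
    (hasSum_complexHermiteTerm_fiber s t z₁ z₂)
  exact ⟨h.summable.norm, h⟩
end

section
/- Let 0 < α < 1 and m, n ∈ ℕ. Then ∫_{ℝ²} H_m(x+iy) · conj(H_n(x+iy)) · exp(−(1−α)x² − (1/α − 1)y²) dx dy = (π√α/(1−α)) · (2(1+α)/(1−α))^n · n! if m = n, and the integral equals 0 if m ≠ n. -/
open Finset MeasureTheory
open scoped Nat

open Polynomial

/-- The Hermite polynomial as an element of `ℂ[X]`, defined by the raising operator. -/
noncomputable def hermitePoly : ℕ → ℂ[X]
  | 0 => 1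
  | n + 1 => 2 * X * hermitePoly n - derivative (hermitePoly n)

lemma hermitePoly_succ (n : ℕ) :
    hermitePoly (n + 1) = 2 * X * hermitePoly n - derivative (hermitePoly n) := rfl

lemma derivative_hermitePoly_succ (n : ℕ) :
    derivative (hermitePoly (n + 1)) = 2 * ((n : ℂ[X]) + 1) * hermitePoly n := by
  induction n with
  | zero => simp [hermitePoly]
  | succ k ih =>
    have h2 : derivative (hermitePoly (k + 2)) = 2 * hermitePoly (k + 1)
        + 2 * X * derivative (hermitePoly (k + 1))
        - derivative (derivative (hermitePoly (k + 1))) := by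
      rw [hermitePoly_succ (k + 1)]
      simp
    have h3 : derivative (derivative (hermitePoly (k + 1)))
        = 2 * ((k : ℂ[X]) + 1) * derivative (hermitePoly k) := by
      rw [ih]
      simp
    rw [h2, h3, ih]
    push_cast
    linear_combination (-2 * ((k : ℂ[X]) + 1)) * hermitePoly_succ k

/-- The `m`-th term of `H_n(z) / n!`, extended by zero to `2 * m > n`. -/
noncomputable def hermiteTerm (z : ℂ) (n m : ℕ) : ℂ :=
  if 2 * m ≤ n then ((-1 : ℂ) ^ m * (2 * z) ^ (n - 2 * m)) / ((m ! : ℂ) * ((n - 2 * m)! : ℂ))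
  else 0

lemma hermiteH_eq_sum_hermiteTerm {n N : ℕ} (h : n / 2 < N) (z : ℂ) :
    hermiteH n z = (n ! : ℂ) * ∑ m ∈ range N, hermiteTerm z n m := by
  rw [hermiteH]
  congr 1
  rw [← Finset.sum_subset (s₁ := range (n / 2 + 1)) (Finset.range_mono h)]
  · refine Finset.sum_congr rfl fun m hm => ?_
    rw [hermiteTerm, if_pos]
    have := Finset.mem_range.1 hm
    omega
  · intro m _ hm
    rw [hermiteTerm, if_neg]
    simp only [Finset.mem_range] at hm
    omega

lemma hermiteTerm_zero_recurrence (z : ℂ) (n : ℕ) :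
    ((n : ℂ) + 2) * hermiteTerm z (n + 2) 0 = 2 * z * hermiteTerm z (n + 1) 0 := by
  have h1 : (n : ℂ) + 2 ≠ 0 := by exact_mod_cast (n + 1).succ_ne_zero
  have h2 : ((n + 1)! : ℂ) ≠ 0 := by exact_mod_cast (n + 1).factorial_ne_zero
  have h3 : ((n + 2)! : ℂ) = ((n : ℂ) + 2) * ((n + 1)! : ℂ) := by
    rw [Nat.factorial_succ (n + 1)]; push_cast; ring
  simp only [hermiteTerm, mul_zero, Nat.zero_le, if_true, Nat.sub_zero, h3]
  field_simp
  ring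

lemma hermiteTerm_succ_recurrence (z : ℂ) (n m : ℕ) :
    ((n : ℂ) + 2) * hermiteTerm z (n + 2) (m + 1) =
      2 * z * hermiteTerm z (n + 1) (m + 1) - 2 * hermiteTerm z n m := by
  by_cases h : 2 * m ≤ n
  · obtain ⟨k, rfl⟩ := Nat.exists_eq_add_of_le h
    have hm : (m ! : ℂ) ≠ 0 := by exact_mod_cast m.factorial_ne_zero
    have hm1 : (m : ℂ) + 1 ≠ 0 := by exact_mod_cast m.succ_ne_zero
    have hms : ((m + 1)! : ℂ) = ((m : ℂ) + 1) * (m ! : ℂ) := by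
      rw [Nat.factorial_succ]; push_cast; ring
    have e1 : 2 * m + k + 2 - 2 * (m + 1) = k := by omega
    have e2 : 2 * m + k - 2 * m = k := by omega
    rcases k with _ | j
    · rw [hermiteTerm, if_pos (by omega), hermiteTerm, if_neg (by omega), hermiteTerm,
        if_pos (by omega), e1, e2, hms]
      push_cast
      field_simp
      ring
    · have e3 : 2 * m + (j + 1) + 1 - 2 * (m + 1) = j := by omega
      have hj : (j ! : ℂ) ≠ 0 := by exact_mod_cast j.factorial_ne_zero
      have hj1 : (j : ℂ) + 1 ≠ 0 := by exact_mod_cast j.succ_ne_zero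
      have hjs : ((j + 1)! : ℂ) = ((j : ℂ) + 1) * (j ! : ℂ) := by
        rw [Nat.factorial_succ]; push_cast; ring
      rw [hermiteTerm, if_pos (by omega), hermiteTerm, if_pos (by omega), hermiteTerm,
        if_pos (by omega), e1, e2, e3, hms, hjs]
      push_cast
      field_simp
      ring
  · rw [hermiteTerm, if_neg (by omega), hermiteTerm, if_neg (by omega), hermiteTerm,
      if_neg h]
    ring

lemma hermiteH_recurrence (z : ℂ) (n : ℕ) :
    hermiteH (n + 2) z = 2 * z * hermiteH (n + 1) z - 2 * ((n : ℂ) + 1) * hermiteH n z := by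
  rw [hermiteH_eq_sum_hermiteTerm (N := n + 2 + 1) (by omega),
    hermiteH_eq_sum_hermiteTerm (N := n + 2 + 1) (n := n + 1) (by omega),
    hermiteH_eq_sum_hermiteTerm (N := n + 2) (n := n) (by omega)]
  have key : ((n : ℂ) + 2) * ∑ m ∈ range (n + 2 + 1), hermiteTerm z (n + 2) m =
      2 * z * ∑ m ∈ range (n + 2 + 1), hermiteTerm z (n + 1) m
        - 2 * ∑ m ∈ range (n + 2), hermiteTerm z n m := by
    rw [Finset.sum_range_succ', Finset.sum_range_succ' (hermiteTerm z (n + 1)), mul_add, mul_add,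
      hermiteTerm_zero_recurrence, Finset.mul_sum, Finset.mul_sum, Finset.mul_sum]
    simp only [hermiteTerm_succ_recurrence, Finset.sum_sub_distrib]
    ring
  rw [Nat.factorial_succ (n + 1), Nat.factorial_succ n]
  push_cast
  linear_combination ((n : ℂ) + 1) * (n ! : ℂ) * key

lemma hermiteH_eq_eval (n : ℕ) (z : ℂ) : hermiteH n z = (hermitePoly n).eval z := by
  induction n using Nat.twoStepInduction with
  | zero => simp [hermiteH, hermitePoly]
  | one => simp [hermiteH, hermitePoly]
  | more n h0 h1 =>
    rw [hermiteH_recurrence, h0, h1, hermitePoly_succ (n + 1), derivative_hermitePoly_succ]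
    simp

lemma conj_hermiteH (n : ℕ) (z : ℂ) :
    (starRingEnd ℂ) (hermiteH n z) = hermiteH n ((starRingEnd ℂ) z) := by
  simp [hermiteH, map_sum, map_ofNat]

/-- The integrand `f(x + iy) g(x - iy) exp(-a x² - b y²)`. -/
noncomputable def gaussIntegrand (a b : ℝ) (f g : ℂ[X]) (p : ℝ × ℝ) : ℂ :=
  f.eval (p.1 + p.2 * Complex.I) * g.eval (p.1 - p.2 * Complex.I) *
    (Real.exp (-a * p.1 ^ 2 - b * p.2 ^ 2) : ℂ)

/-- The bilinear pairing `∫ f(x + iy) g(x - iy) exp(-a x² - b y²) dx dy`. -/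
noncomputable def gaussPairing (a b : ℝ) (f g : ℂ[X]) : ℂ :=
  ∫ p, gaussIntegrand a b f g p

lemma integrable_abs_pow_mul_gaussian {b : ℝ} (hb : 0 < b) (n : ℕ) :
    Integrable fun x : ℝ => |x| ^ n * Real.exp (-b * x ^ 2) := by
  have h := (integrable_rpow_mul_exp_neg_mul_sq hb
    (s := n) (by linarith [n.cast_nonneg (α := ℝ)])).norm
  refine h.congr (Filter.Eventually.of_forall fun x => ?_)
  simp [Real.rpow_natCast]

lemma integrable_gaussIntegrand_monomial {a b : ℝ} (ha : 0 < a) (hb : 0 < b)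
    (j k : ℕ) (c d : ℂ) :
    Integrable (gaussIntegrand a b (monomial j c) (monomial k d)) := by
  have h1 := (integrable_abs_pow_mul_gaussian ha (j + k)).mul_prod
    (integrable_abs_pow_mul_gaussian hb 0)
  have h2 := (integrable_abs_pow_mul_gaussian ha 0).mul_prod
    (integrable_abs_pow_mul_gaussian hb (j + k))
  refine ((h1.add h2).const_mul (‖c‖ * ‖d‖ * 2 ^ (j + k - 1))).mono' ?_ ?_
  · refine Continuous.aestronglyMeasurable ?_
    unfold gaussIntegrand
    fun_prop
  · refine Filter.Eventually.of_forall fun p => ?_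
    have hp : ‖(p.1 : ℂ) + p.2 * Complex.I‖ ≤ |p.1| + |p.2| := by
      refine (norm_add_le _ _).trans (by simp)
    have hm : ‖(p.1 : ℂ) - p.2 * Complex.I‖ ≤ |p.1| + |p.2| := by
      refine (norm_sub_le _ _).trans (by simp)
    have hexp : Real.exp (-a * p.1 ^ 2 - b * p.2 ^ 2) =
        Real.exp (-a * p.1 ^ 2) * Real.exp (-b * p.2 ^ 2) := by
      rw [← Real.exp_add]; ring_nf
    simp only [gaussIntegrand, eval_monomial, norm_mul, norm_pow, Complex.norm_real,
      Real.norm_eq_abs, Real.abs_exp, hexp, Pi.add_apply]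
    calc _ ≤ ‖c‖ * (|p.1| + |p.2|) ^ j * (‖d‖ * (|p.1| + |p.2|) ^ k) *
          (Real.exp (-a * p.1 ^ 2) * Real.exp (-b * p.2 ^ 2)) := by gcongr
      _ = ‖c‖ * ‖d‖ * (|p.1| + |p.2|) ^ (j + k) *
          (Real.exp (-a * p.1 ^ 2) * Real.exp (-b * p.2 ^ 2)) := by ring
      _ ≤ ‖c‖ * ‖d‖ * (2 ^ (j + k - 1) * (|p.1| ^ (j + k) + |p.2| ^ (j + k))) *
          (Real.exp (-a * p.1 ^ 2) * Real.exp (-b * p.2 ^ 2)) := by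
        gcongr
        exact add_pow_le (abs_nonneg _) (abs_nonneg _) _
      _ = _ := by ring

lemma integrable_gaussIntegrand {a b : ℝ} (ha : 0 < a) (hb : 0 < b) (f g : ℂ[X]) :
    Integrable (gaussIntegrand a b f g) := by
  induction f using Polynomial.induction_on' with
  | add f₁ f₂ h₁ h₂ =>
    refine (h₁.add h₂).congr (Filter.Eventually.of_forall fun p => ?_)
    simp [gaussIntegrand, add_mul]
  | monomial j c =>
    induction g using Polynomial.induction_on' with
    | add g₁ g₂ h₁ h₂ =>
      refine (h₁.add h₂).congr (Filter.Eventually.of_forall fun p => ?_)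
      simp [gaussIntegrand, add_mul, mul_add]
    | monomial k d => exact integrable_gaussIntegrand_monomial ha hb j k c d

lemma hasDerivAt_gaussIntegrand_fst (a b : ℝ) (f g : ℂ[X]) (x y : ℝ) :
    HasDerivAt (fun x : ℝ => gaussIntegrand a b f g (x, y))
      (gaussIntegrand a b (derivative f) g (x, y) + gaussIntegrand a b f (derivative g) (x, y)
        - a * (gaussIntegrand a b (X * f) g (x, y) + gaussIntegrand a b f (X * g) (x, y))) x := by
  have hx : HasDerivAt (fun x : ℝ => (x : ℂ)) 1 x := Complex.ofRealCLM.hasDerivAt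
  have hf := (f.hasDerivAt ((x : ℂ) + y * Complex.I)).comp x (hx.add_const (y * Complex.I))
  have hg := (g.hasDerivAt ((x : ℂ) - y * Complex.I)).comp x (hx.sub_const (y * Complex.I))
  have hw : HasDerivAt (fun x : ℝ => -a * x ^ 2 - b * y ^ 2) (-a * (2 * x)) x := by
    simpa using ((hasDerivAt_pow 2 x).const_mul (-a)).sub_const (b * y ^ 2)
  refine ((hf.mul hg).mul hw.exp.ofReal_comp).congr_deriv ?_
  simp only [gaussIntegrand, Function.comp_apply, eval_mul, eval_X, Pi.mul_apply]
  push_cast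
  ring

lemma hasDerivAt_gaussIntegrand_snd (a b : ℝ) (f g : ℂ[X]) (x y : ℝ) :
    HasDerivAt (fun y : ℝ => gaussIntegrand a b f g (x, y))
      (Complex.I * (gaussIntegrand a b (derivative f) g (x, y)
        - gaussIntegrand a b f (derivative g) (x, y)
        + b * (gaussIntegrand a b (X * f) g (x, y) - gaussIntegrand a b f (X * g) (x, y)))) y := by
  have hy : HasDerivAt (fun y : ℝ => (y : ℂ) * Complex.I) Complex.I y := by
    simpa using (Complex.ofRealCLM.hasDerivAt (x := y)).mul_const Complex.I
  have hf := (f.hasDerivAt ((x : ℂ) + y * Complex.I)).comp y (hy.const_add (x : ℂ))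
  have hg := (g.hasDerivAt ((x : ℂ) - y * Complex.I)).comp y (hy.const_sub (x : ℂ))
  have hw : HasDerivAt (fun y : ℝ => -a * x ^ 2 - b * y ^ 2) (-(b * (2 * y))) y := by
    simpa using ((hasDerivAt_pow 2 y).const_mul b).const_sub (-(a * x ^ 2))
  refine ((hf.mul hg).mul hw.exp.ofReal_comp).congr_deriv ?_
  simp only [gaussIntegrand, Function.comp_apply, eval_mul, eval_X, Pi.mul_apply]
  push_cast
  linear_combination (2 * b * y * eval ((x : ℂ) + y * Complex.I) f *
    eval ((x : ℂ) - y * Complex.I) g *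
      Complex.exp (-a * x ^ 2 - b * y ^ 2)) * (-Complex.I_sq)

lemma gaussPairing_derivative_add {a b : ℝ} (ha : 0 < a) (hb : 0 < b) (f g : ℂ[X]) :
    gaussPairing a b (derivative f) g + gaussPairing a b f (derivative g) =
      a * (gaussPairing a b (X * f) g + gaussPairing a b f (X * g)) := by
  have hint := integrable_gaussIntegrand ha hb
  have h1 : Integrable fun p => gaussIntegrand a b (derivative f) g p
      + gaussIntegrand a b f (derivative g) p :=
    (hint (derivative f) g).add (hint f (derivative g))
  have h2 : Integrable fun p => (a : ℂ) * (gaussIntegrand a b (X * f) g p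
      + gaussIntegrand a b f (X * g) p) :=
    ((hint (X * f) g).add (hint f (X * g))).const_mul (a : ℂ)
  have h3 : Integrable fun p => gaussIntegrand a b (derivative f) g p
      + gaussIntegrand a b f (derivative g) p
      - a * (gaussIntegrand a b (X * f) g p + gaussIntegrand a b f (X * g) p) := h1.sub h2
  have key : ∫ p, (gaussIntegrand a b (derivative f) g p + gaussIntegrand a b f (derivative g) p
      - a * (gaussIntegrand a b (X * f) g p + gaussIntegrand a b f (X * g) p)) = 0 := by
    rw [Measure.volume_eq_prod, integral_prod_symm _ h3]
    refine integral_eq_zero_of_ae ?_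
    filter_upwards [h3.prod_left_ae, (hint f g).prod_left_ae] with y hy' hy
    exact integral_eq_zero_of_hasDerivAt_of_integrable
      (fun x => hasDerivAt_gaussIntegrand_fst a b f g x y) hy' hy
  rw [integral_sub h1 h2, integral_const_mul, integral_add (hint _ _) (hint _ _),
    integral_add (hint _ _) (hint _ _)] at key
  exact sub_eq_zero.1 key

lemma gaussPairing_derivative_sub {a b : ℝ} (ha : 0 < a) (hb : 0 < b) (f g : ℂ[X]) :
    gaussPairing a b (derivative f) g - gaussPairing a b f (derivative g) =
      -b * (gaussPairing a b (X * f) g - gaussPairing a b f (X * g)) := by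
  have hint := integrable_gaussIntegrand ha hb
  have h1 : Integrable fun p => gaussIntegrand a b (derivative f) g p
      - gaussIntegrand a b f (derivative g) p :=
    (hint (derivative f) g).sub (hint f (derivative g))
  have h2 : Integrable fun p => (b : ℂ) * (gaussIntegrand a b (X * f) g p
      - gaussIntegrand a b f (X * g) p) :=
    ((hint (X * f) g).sub (hint f (X * g))).const_mul (b : ℂ)
  have h3 : Integrable fun p => Complex.I * (gaussIntegrand a b (derivative f) g p
      - gaussIntegrand a b f (derivative g) p
      + b * (gaussIntegrand a b (X * f) g p - gaussIntegrand a b f (X * g) p)) :=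
    (h1.add h2).const_mul Complex.I
  have key : ∫ p, Complex.I * (gaussIntegrand a b (derivative f) g p
      - gaussIntegrand a b f (derivative g) p
      + b * (gaussIntegrand a b (X * f) g p - gaussIntegrand a b f (X * g) p)) = 0 := by
    rw [Measure.volume_eq_prod, integral_prod _ h3]
    refine integral_eq_zero_of_ae ?_
    filter_upwards [h3.prod_right_ae, (hint f g).prod_right_ae] with x hx' hx
    exact integral_eq_zero_of_hasDerivAt_of_integrable
      (fun y => hasDerivAt_gaussIntegrand_snd a b f g x y) hx' hx
  rw [integral_const_mul, integral_add h1 h2, integral_const_mul, integral_sub (hint _ _) (hint _ _),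
    integral_sub (hint _ _) (hint _ _)] at key
  have := (mul_eq_zero.1 key).resolve_left Complex.I_ne_zero
  unfold gaussPairing
  linear_combination this

lemma two_mul_gaussPairing_X_mul {a b : ℝ} (ha : 0 < a) (hb : 0 < b) (f g : ℂ[X]) :
    2 * gaussPairing a b (X * f) g =
      ((1 / a - 1 / b : ℝ) : ℂ) * gaussPairing a b (derivative f) g +
        ((1 / a + 1 / b : ℝ) : ℂ) * gaussPairing a b f (derivative g) := by
  have ha' : (a : ℂ) ≠ 0 := by exact_mod_cast ha.ne'
  have hb' : (b : ℂ) ≠ 0 := by exact_mod_cast hb.ne'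
  have h1 := gaussPairing_derivative_add ha hb f g
  have h2 := gaussPairing_derivative_sub ha hb f g
  push_cast
  field_simp
  linear_combination (-(b : ℂ)) * h1 + (a : ℂ) * h2

lemma gaussPairing_sub_left {a b : ℝ} (ha : 0 < a) (hb : 0 < b) (f₁ f₂ g : ℂ[X]) :
    gaussPairing a b (f₁ - f₂) g = gaussPairing a b f₁ g - gaussPairing a b f₂ g := by
  rw [gaussPairing, gaussPairing, gaussPairing, ← integral_sub
    (integrable_gaussIntegrand ha hb _ _) (integrable_gaussIntegrand ha hb _ _)]
  simp [gaussIntegrand, sub_mul]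

lemma gaussPairing_C_mul_left (a b : ℝ) (c : ℂ) (f g : ℂ[X]) :
    gaussPairing a b (C c * f) g = c * gaussPairing a b f g := by
  rw [gaussPairing, gaussPairing, ← integral_const_mul]
  simp [gaussIntegrand, mul_assoc]

lemma gaussPairing_C_mul_right (a b : ℝ) (c : ℂ) (f g : ℂ[X]) :
    gaussPairing a b f (C c * g) = c * gaussPairing a b f g := by
  rw [gaussPairing, gaussPairing, ← integral_const_mul]
  simp [gaussIntegrand, mul_assoc, mul_left_comm]

lemma gaussPairing_zero_right (a b : ℝ) (f : ℂ[X]) : gaussPairing a b f 0 = 0 := by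
  simp [gaussPairing, gaussIntegrand]

/-- When `1 / a - 1 / b = 1`, the raising operator `2 z - d/dz` is adjoint to a multiple of the
derivative. -/
lemma gaussPairing_hermitePoly_succ {a b : ℝ} (ha : 0 < a) (hb : 0 < b)
    (hab : 1 / a - 1 / b = 1) (m : ℕ) (g : ℂ[X]) :
    gaussPairing a b (hermitePoly (m + 1)) g =
      ((1 / a + 1 / b : ℝ) : ℂ) * gaussPairing a b (hermitePoly m) (derivative g) := by
  have h := two_mul_gaussPairing_X_mul ha hb (hermitePoly m) g
  have hC : (2 * X * hermitePoly m : ℂ[X]) = C 2 * (X * hermitePoly m) := by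
    rw [mul_assoc]; rfl
  rw [hab] at h
  rw [hermitePoly_succ, gaussPairing_sub_left ha hb, hC, gaussPairing_C_mul_left, h]
  push_cast
  ring

lemma gaussPairing_comm {a b : ℝ} (ha : 0 < a) (hb : 0 < b) (f g : ℂ[X]) :
    gaussPairing a b f g = gaussPairing a b g f := by
  rw [gaussPairing, gaussPairing, Measure.volume_eq_prod,
    integral_prod _ (integrable_gaussIntegrand ha hb f g),
    integral_prod _ (integrable_gaussIntegrand ha hb g f)]
  congr 1 with x
  rw [← integral_neg_eq_self]
  simp [gaussIntegrand, mul_comm, sub_eq_add_neg]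

lemma gaussPairing_one_one (a b : ℝ) :
    gaussPairing a b 1 1 = ((√(Real.pi / a) * √(Real.pi / b) : ℝ) : ℂ) := by
  have h : gaussIntegrand a b 1 1 = fun p : ℝ × ℝ =>
      ((Real.exp (-a * p.1 ^ 2) : ℝ) : ℂ) * ((Real.exp (-b * p.2 ^ 2) : ℝ) : ℂ) := by
    ext p
    rw [gaussIntegrand, ← Complex.ofReal_mul, ← Real.exp_add]
    simp [sub_eq_add_neg]
  rw [gaussPairing, h, Measure.volume_eq_prod,
    integral_prod_mul (fun x : ℝ => ((Real.exp (-a * x ^ 2) : ℝ) : ℂ))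
      (fun y : ℝ => ((Real.exp (-b * y ^ 2) : ℝ) : ℂ)), integral_complex_ofReal,
    integral_complex_ofReal, integral_gaussian, integral_gaussian, Complex.ofReal_mul]

lemma gaussPairing_hermitePoly {a b : ℝ} (ha : 0 < a) (hb : 0 < b)
    (hab : 1 / a - 1 / b = 1) (m n : ℕ) :
    gaussPairing a b (hermitePoly m) (hermitePoly n) =
      if m = n then
        ((2 * (1 / a + 1 / b) : ℝ) : ℂ) ^ n * (n ! : ℂ) * gaussPairing a b 1 1
      else 0 := by
  induction m generalizing n with
  | zero =>
    cases n with
    | zero => simp [hermitePoly]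
    | succ n =>
      rw [gaussPairing_comm ha hb, gaussPairing_hermitePoly_succ ha hb hab]
      simp [hermitePoly, gaussPairing_zero_right]
  | succ m ih =>
    rw [gaussPairing_hermitePoly_succ ha hb hab]
    cases n with
    | zero => simp [hermitePoly, gaussPairing_zero_right]
    | succ n =>
      have hC : (2 * ((n : ℂ[X]) + 1) * hermitePoly n : ℂ[X]) =
          C (2 * ((n : ℂ) + 1)) * hermitePoly n := by
        rw [map_mul, map_add, map_natCast, map_one, map_ofNat]
      rw [derivative_hermitePoly_succ, hC, gaussPairing_C_mul_right, ih]
      by_cases h : m = n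
      · rw [if_pos h, if_pos (congrArg (· + 1) h), Nat.factorial_succ]
        push_cast
        ring
      · rw [if_neg h, if_neg (by simpa using h)]
        ring

/-- Orthogonality of the holomorphic (Eijndhoven–Meyers) Hermite polynomials with respect
to the non-rotationally-invariant Gaussian measure: for `0 < α < 1`,
`∫_{ℝ²} H_m(x+iy) conj(H_n(x+iy)) e^{−(1−α)x² − (1/α−1)y²} dx dy
  = (π√α/(1−α)) (2(1+α)/(1−α))^n n! δ_{mn}`. -/
theorem eijndhoven_meyers_orthogonality (α : ℝ) (hα0 : 0 < α) (hα1 : α < 1) (m n : ℕ) :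
    (∫ x : ℝ, ∫ y : ℝ,
        hermiteH m (x + y * Complex.I) * (starRingEnd ℂ) (hermiteH n (x + y * Complex.I)) *
          Real.exp (-(1 - α) * x ^ 2 - (1 / α - 1) * y ^ 2)) =
      if m = n then
        ((Real.pi * Real.sqrt α / (1 - α) : ℝ) : ℂ) *
          ((2 * (1 + α) / (1 - α) : ℝ) : ℂ) ^ n * (n ! : ℂ)
      else 0 := by
  have h1 : 0 < 1 - α := sub_pos.2 hα1
  have ha0 : α ≠ 0 := hα0.ne'
  have h1' : 1 - α ≠ 0 := h1.ne'
  have hb_eq : 1 / α - 1 = (1 - α) / α := by field_simp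
  have hb : 0 < 1 / α - 1 := hb_eq ▸ div_pos h1 hα0
  have hab : 1 / (1 - α) - 1 / (1 / α - 1) = 1 := by
    rw [hb_eq]
    field_simp
  have hκ : 2 * (1 / (1 - α) + 1 / (1 / α - 1)) = 2 * (1 + α) / (1 - α) := by
    rw [hb_eq]
    field_simp
  have hπ : √(Real.pi / (1 - α)) * √(Real.pi / (1 / α - 1)) = Real.pi * √α / (1 - α) := by
    rw [← Real.sqrt_mul (by positivity), hb_eq,
      show Real.pi / (1 - α) * (Real.pi / ((1 - α) / α)) = (Real.pi / (1 - α)) ^ 2 * α by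
        field_simp,
      Real.sqrt_mul (by positivity), Real.sqrt_sq (by positivity)]
    ring
  have hconj (x y : ℝ) : (starRingEnd ℂ) (x + y * Complex.I) = x - y * Complex.I := by
    simp [sub_eq_add_neg]
  have hmain := gaussPairing_hermitePoly h1 hb hab m n
  rw [gaussPairing_one_one, hκ, hπ, gaussPairing, Measure.volume_eq_prod,
    integral_prod _ (integrable_gaussIntegrand h1 hb _ _)] at hmain
  simp only [conj_hermiteH, hconj]
  simp only [hermiteH_eq_eval]
  refine hmain.trans ?_
  split_ifs
  · ring
  · rfl
end

section
/- For every 0 < α < 1 and every z ∈ ℂ, the series ∑_{n=0}^{∞} |h_n^{(α)}(z)|² converges (is finite). -/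
open Finset
open scoped Nat

/-- The holomorphic Hermite function
`h_n^{(α)}(z) = (2√α/(1+α))^{1/2} ((1−α)/(1+α))^{n/2} (2^n n!)^{−1/2}
  exp(((1−α)/(1+α)) z²/2) H_n(√(2α/(1−α²)) z)`. -/
noncomputable def holomorphicHermite (α : ℝ) (n : ℕ) (z : ℂ) : ℂ :=
  (Real.sqrt (2 * Real.sqrt α / (1 + α)) : ℂ) *
    ((Real.sqrt ((1 - α) / (1 + α)) : ℝ) : ℂ) ^ n *
    (1 / (Real.sqrt (2 ^ n * n !) : ℂ)) *
    Complex.exp ((((1 - α) / (1 + α) : ℝ) : ℂ) * z ^ 2 / 2) *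
    hermiteH n ((Real.sqrt (2 * α / (1 - α ^ 2)) : ℂ) * z)

theorem hermiteTerm_sq_le (m k : ℕ) {r t : ℝ} (ht : 0 < t) :
    (((2 * m + k)! : ℝ) * ((2 * r) ^ k / ((m ! : ℝ) * (k ! : ℝ)))) ^ 2 ≤
      2 ^ (2 * m + k) * ((2 * m + k)! : ℝ) * Real.exp (2 * r ^ 2 / t) *
        (t ^ k * ((2 * m + k).choose (2 * m) : ℝ)) := by
  have hchoose : ((2 * m + k)! : ℝ) =
      ((2 * m + k).choose (2 * m) : ℝ) * ((2 * m)! : ℝ) * (k ! : ℝ) := by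
    have h := Nat.choose_mul_factorial_mul_factorial (Nat.le_add_right (2 * m) k)
    rw [Nat.add_sub_cancel_left] at h
    exact_mod_cast h.symm
  have hcentral : ((2 * m)! : ℝ) = (m.centralBinom : ℝ) * (m ! : ℝ) * (m ! : ℝ) := by
    have h := Nat.choose_mul_factorial_mul_factorial (Nat.le_mul_of_pos_left m two_pos)
    rw [show 2 * m - m = m by omega, ← Nat.centralBinom_eq_two_mul_choose] at h
    exact_mod_cast h.symm
  have hcentral_le : (m.centralBinom : ℝ) ≤ 4 ^ m := by
    have h := Nat.sum_range_choose (2 * m)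
    have h' : m.centralBinom ≤ ∑ i ∈ Finset.range (2 * m + 1), (2 * m).choose i :=
      Finset.single_le_sum (f := fun i => (2 * m).choose i) (fun _ _ => Nat.zero_le _)
        (Finset.mem_range.2 (by omega))
    rw [h, pow_mul] at h'
    exact_mod_cast h'
  have hexp : (2 * r ^ 2 / t) ^ k / (k ! : ℝ) ≤ Real.exp (2 * r ^ 2 / t) :=
    Real.pow_div_factorial_le_exp _ (by positivity) k
  have hm : (m ! : ℝ) ≠ 0 := by positivity
  have hk : (k ! : ℝ) ≠ 0 := by positivity
  calc (((2 * m + k)! : ℝ) * ((2 * r) ^ k / ((m ! : ℝ) * (k ! : ℝ)))) ^ 2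
      = ((2 * m + k)! : ℝ) * (((2 * m + k).choose (2 * m) : ℝ) * ((2 * m)! : ℝ) * (k ! : ℝ)) *
          ((2 * r) ^ k / ((m ! : ℝ) * (k ! : ℝ))) ^ 2 := by rw [← hchoose]; ring
    _ = (m.centralBinom : ℝ) * ((2 * r ^ 2 / t) ^ k / (k ! : ℝ)) *
          (2 ^ k * ((2 * m + k)! : ℝ) * (t ^ k * ((2 * m + k).choose (2 * m) : ℝ))) := by
        rw [hcentral]
        have h : ((2 * r) ^ k) ^ 2 = (2 * r ^ 2 / t) ^ k * 2 ^ k * t ^ k := by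
          rw [← mul_pow, ← mul_pow, pow_right_comm]
          congr 1
          field_simp
        rw [div_pow, h]
        field_simp
    _ ≤ 4 ^ m * Real.exp (2 * r ^ 2 / t) *
          (2 ^ k * ((2 * m + k)! : ℝ) * (t ^ k * ((2 * m + k).choose (2 * m) : ℝ))) := by
        gcongr
    _ = _ := by
        rw [pow_add, pow_mul]
        norm_num
        ring

theorem sum_even_choose_le (n : ℕ) {t : ℝ} (ht : 0 ≤ t) :
    ∑ m ∈ Finset.range (n / 2 + 1), t ^ (n - 2 * m) * (n.choose (2 * m) : ℝ) ≤ (1 + t) ^ n := by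
  rw [add_pow, ← Finset.sum_image (s := Finset.range (n / 2 + 1)) (g := fun m => 2 * m)
    (f := fun j => t ^ (n - j) * (n.choose j : ℝ)) (fun a _ b _ h => by simpa using h)]
  simp only [one_pow, one_mul]
  refine Finset.sum_le_sum_of_subset_of_nonneg (fun j hj => ?_) (fun _ _ _ => by positivity)
  obtain ⟨m, hm, rfl⟩ := Finset.mem_image.1 hj
  rw [Finset.mem_range] at hm ⊢
  omega

theorem norm_hermiteH_sq_le (n : ℕ) (w : ℂ) {t : ℝ} (ht : 0 < t) :
    ‖hermiteH n w‖ ^ 2 ≤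
      2 ^ n * (n ! : ℝ) * Real.exp (2 * ‖w‖ ^ 2 / t) * ((n + 1) * (1 + t) ^ n) := by
  have hnorm : ‖hermiteH n w‖ ≤ ∑ m ∈ Finset.range (n / 2 + 1),
      (n ! : ℝ) * ((2 * ‖w‖) ^ (n - 2 * m) / ((m ! : ℝ) * ((n - 2 * m)! : ℝ))) := by
    rw [hermiteH, Finset.mul_sum]
    refine (norm_sum_le _ _).trans (le_of_eq (Finset.sum_congr rfl fun m _ => ?_))
    simp
  have hterm : ∀ m ∈ Finset.range (n / 2 + 1),
      ((n ! : ℝ) * ((2 * ‖w‖) ^ (n - 2 * m) / ((m ! : ℝ) * ((n - 2 * m)! : ℝ)))) ^ 2 ≤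
        2 ^ n * (n ! : ℝ) * Real.exp (2 * ‖w‖ ^ 2 / t) *
          (t ^ (n - 2 * m) * (n.choose (2 * m) : ℝ)) := by
    intro m hm
    rw [Finset.mem_range] at hm
    have h := hermiteTerm_sq_le m (n - 2 * m) (r := ‖w‖) ht
    rwa [show 2 * m + (n - 2 * m) = n by omega] at h
  have hcard : ((n / 2 + 1 : ℕ) : ℝ) ≤ n + 1 := by
    exact_mod_cast Nat.succ_le_succ (Nat.div_le_self n 2)
  calc ‖hermiteH n w‖ ^ 2
      ≤ (∑ m ∈ Finset.range (n / 2 + 1),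
          (n ! : ℝ) * ((2 * ‖w‖) ^ (n - 2 * m) / ((m ! : ℝ) * ((n - 2 * m)! : ℝ)))) ^ 2 := by
        gcongr
    _ ≤ ((n / 2 + 1 : ℕ) : ℝ) * ∑ m ∈ Finset.range (n / 2 + 1),
          ((n ! : ℝ) * ((2 * ‖w‖) ^ (n - 2 * m) / ((m ! : ℝ) * ((n - 2 * m)! : ℝ)))) ^ 2 := by
        simpa only [Finset.card_range] using
          sq_sum_le_card_mul_sum_sq (s := Finset.range (n / 2 + 1))
    _ ≤ (n + 1) * (2 ^ n * (n ! : ℝ) * Real.exp (2 * ‖w‖ ^ 2 / t) * (1 + t) ^ n) := by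
        refine mul_le_mul hcard ((Finset.sum_le_sum hterm).trans ?_)
          (Finset.sum_nonneg fun _ _ => sq_nonneg _) (by positivity)
        rw [← Finset.mul_sum]
        gcongr
        exact sum_even_choose_le n ht.le
    _ = _ := by ring

/-- For every `0 < α < 1` and every `z ∈ ℂ`, the series
`∑_{n=0}^{∞} |h_n^{(α)}(z)|²` converges. -/
theorem holomorphicHermite_sq_summable (α : ℝ) (hα0 : 0 < α) (hα1 : α < 1) (z : ℂ) :
    Summable (fun n : ℕ => ‖holomorphicHermite α n z‖ ^ 2) := by
  set q := (1 - α) / (1 + α) with hq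
  have hq0 : 0 < q := div_pos (by linarith) (by linarith)
  have hq1 : q < 1 := (div_lt_one (by linarith)).2 (by linarith)
  obtain ⟨t, ht, hqt⟩ : ∃ t : ℝ, 0 < t ∧ q * (1 + t) < 1 := by
    refine ⟨(1 - q) / 2, by linarith, by nlinarith⟩
  set w : ℂ := (Real.sqrt (2 * α / (1 - α ^ 2)) : ℂ) * z
  set A : ℝ := ‖(Real.sqrt (2 * Real.sqrt α / (1 + α)) : ℂ)‖
  set E : ℝ := ‖Complex.exp ((q : ℂ) * z ^ 2 / 2)‖
  have hgeom : Summable fun n : ℕ => ((n : ℝ) + 1) * (q * (1 + t)) ^ n := by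
    have hp : ‖q * (1 + t)‖ < 1 := by rwa [Real.norm_of_nonneg (by positivity)]
    simpa [add_mul] using (summable_pow_mul_geometric_of_norm_lt_one 1 hp).add
      (summable_geometric_of_norm_lt_one hp)
  refine Summable.of_nonneg_of_le (fun _ => sq_nonneg _) (fun n => ?_)
    (hgeom.mul_left (A ^ 2 * E ^ 2 * Real.exp (2 * ‖w‖ ^ 2 / t)))
  have hN : (0 : ℝ) < 2 ^ n * n ! := by positivity
  have hsq : ‖holomorphicHermite α n z‖ ^ 2 =
      A ^ 2 * q ^ n * (1 / (2 ^ n * n !)) * E ^ 2 * ‖hermiteH n w‖ ^ 2 := by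
    have h1 : ‖((Real.sqrt q : ℝ) : ℂ) ^ n‖ ^ 2 = q ^ n := by
      rw [norm_pow, Complex.norm_real, Real.norm_of_nonneg (Real.sqrt_nonneg _), pow_right_comm,
        Real.sq_sqrt hq0.le]
    have h2 : ‖1 / (Real.sqrt (2 ^ n * n !) : ℂ)‖ ^ 2 = 1 / (2 ^ n * n !) := by
      rw [norm_div, norm_one, Complex.norm_real, Real.norm_of_nonneg (Real.sqrt_nonneg _), div_pow,
        Real.sq_sqrt hN.le, one_pow]
    rw [holomorphicHermite, norm_mul, norm_mul, norm_mul, norm_mul, mul_pow, mul_pow, mul_pow,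
      mul_pow, h1, h2]
  rw [hsq]
  calc A ^ 2 * q ^ n * (1 / (2 ^ n * n !)) * E ^ 2 * ‖hermiteH n w‖ ^ 2
      ≤ A ^ 2 * q ^ n * (1 / (2 ^ n * n !)) * E ^ 2 *
        (2 ^ n * (n ! : ℝ) * Real.exp (2 * ‖w‖ ^ 2 / t) * ((n + 1) * (1 + t) ^ n)) := by
        gcongr
        exact norm_hermiteH_sq_le n w ht
    _ = _ := by
        rw [mul_pow]
        field_simp
end

section
/- For every 0 < α < 1 and all z₁, z₂ ∈ ℂ, the double series ∑_{m=0}^{∞} ∑_{n=0}^{∞} |h_{m,n}^{(α)}(z₁,z₂)|² converges (is finite). -/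
open Finset
open scoped Nat

/-- The two-variable holomorphic Hermite function
`h_{m,n}^{(α)}(z₁,z₂) = (2√α/(1+α)) ((1−α)/(1+α))^{(m+n)/2} (m! n!)^{−1/2}
  exp(((1−α)/(1+α)) z₁ z₂) H_{m,n}((2√α/√(1−α²)) z₁, (2√α/√(1−α²)) z₂)`. -/
noncomputable def holomorphicHermite2 (α : ℝ) (m n : ℕ) (z₁ z₂ : ℂ) : ℂ :=
  ((2 * Real.sqrt α / (1 + α) : ℝ) : ℂ) *
    ((Real.sqrt ((1 - α) / (1 + α)) : ℝ) : ℂ) ^ (m + n) *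
    (1 / (Real.sqrt (m ! * n !) : ℂ)) *
    Complex.exp ((((1 - α) / (1 + α) : ℝ) : ℂ) * z₁ * z₂) *
    complexHermite m n (((2 * Real.sqrt α / Real.sqrt (1 - α ^ 2) : ℝ) : ℂ) * z₁)
      (((2 * Real.sqrt α / Real.sqrt (1 - α ^ 2) : ℝ) : ℂ) * z₂)

theorem choose_mul_pow_div_factorial_le {u R : ℝ} (hu : 1 < u) (hR : 0 ≤ R) {m k : ℕ}
    (hk : k ≤ m) :
    (m.choose k : ℝ) * (R ^ (m - k) / (m - k)!) ≤ u ^ m * Real.exp (R / (u - 1)) := by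
  have hu' : 0 < u - 1 := sub_pos.2 hu
  have h_binom : (m.choose k : ℝ) * (u - 1) ^ (m - k) ≤ u ^ m := by
    have h := add_pow (1 : ℝ) (u - 1) m
    rw [add_sub_cancel] at h
    rw [h]
    have h_single := Finset.single_le_sum
      (f := fun j => (1 : ℝ) ^ j * (u - 1) ^ (m - j) * (m.choose j : ℝ))
      (fun j _ => by positivity) (Finset.mem_range.2 (Nat.lt_succ_of_le hk))
    simpa [mul_comm] using h_single
  calc (m.choose k : ℝ) * (R ^ (m - k) / (m - k)!)
      = ((m.choose k : ℝ) * (u - 1) ^ (m - k)) * ((R / (u - 1)) ^ (m - k) / (m - k)!) := by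
        rw [div_pow]
        field_simp
    _ ≤ u ^ m * Real.exp (R / (u - 1)) := by
        gcongr
        exact Real.pow_div_factorial_le_exp _ (by positivity) _

theorem choose_sq_mul_factorial_div {m k : ℕ} (hk : k ≤ m) (R : ℝ) :
    (m.choose k : ℝ) ^ 2 * k ! * R / m ! = m.choose k * (R / (m - k)!) := by
  have h : (m.choose k : ℝ) * k ! * (m - k)! = m ! := by
    exact_mod_cast Nat.choose_mul_factorial_mul_factorial hk
  rw [← h]
  have : (m.choose k : ℝ) ≠ 0 := by exact_mod_cast (Nat.choose_pos hk).ne'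
  field_simp

theorem norm_sq_complexHermite_div_le {u : ℝ} (hu : 1 < u) (w₁ w₂ : ℂ) (m n : ℕ) :
    ‖complexHermite m n w₁ w₂‖ ^ 2 / (m ! * n !) ≤
      Real.exp (‖w₁‖ ^ 2 / (u - 1)) * Real.exp (‖w₂‖ ^ 2 / (u - 1)) *
        (((m + 1) * u ^ m) * ((n + 1) * u ^ n)) := by
  set E₁ := Real.exp (‖w₁‖ ^ 2 / (u - 1))
  set E₂ := Real.exp (‖w₂‖ ^ 2 / (u - 1))
  have hu0 : 0 < u := one_pos.trans hu
  set a : ℕ → ℂ := fun k => (m.choose k : ℂ) * (n.choose k : ℂ) * (-1 : ℂ) ^ k * (k ! : ℂ) *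
      w₁ ^ (m - k) * w₂ ^ (n - k)
  have h_term : ∀ k ∈ Finset.range (min m n + 1),
      ‖a k‖ ^ 2 / (m ! * n !) ≤ (u ^ m * E₁) * (u ^ n * E₂) := by
    intro k hk
    have hkm : k ≤ m := by grind
    have hkn : k ≤ n := by grind
    calc ‖a k‖ ^ 2 / (m ! * n !)
        = ((m.choose k : ℝ) ^ 2 * k ! * (‖w₁‖ ^ 2) ^ (m - k) / m !) *
            ((n.choose k : ℝ) ^ 2 * k ! * (‖w₂‖ ^ 2) ^ (n - k) / n !) := by
          simp only [a, norm_mul, norm_pow, norm_neg, norm_one, one_pow, mul_one,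
            Complex.norm_natCast]
          ring
      _ = (m.choose k * ((‖w₁‖ ^ 2) ^ (m - k) / (m - k)!)) *
            (n.choose k * ((‖w₂‖ ^ 2) ^ (n - k) / (n - k)!)) := by
          rw [choose_sq_mul_factorial_div hkm, choose_sq_mul_factorial_div hkn]
      _ ≤ _ := by
          refine mul_le_mul ?_ ?_ (by positivity) (by positivity)
          · exact choose_mul_pow_div_factorial_le hu (by positivity) hkm
          · exact choose_mul_pow_div_factorial_le hu (by positivity) hkn
  have h_sum : ‖complexHermite m n w₁ w₂‖ ^ 2 ≤
      (min m n + 1 : ℕ) * ∑ k ∈ Finset.range (min m n + 1), ‖a k‖ ^ 2 := by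
    calc ‖complexHermite m n w₁ w₂‖ ^ 2
        ≤ (∑ k ∈ Finset.range (min m n + 1), ‖a k‖) ^ 2 := by
          gcongr
          exact norm_sum_le _ _
      _ ≤ _ := by
          simpa using sq_sum_le_card_mul_sum_sq (s := Finset.range (min m n + 1))
            (f := fun k => ‖a k‖)
  calc ‖complexHermite m n w₁ w₂‖ ^ 2 / (m ! * n !)
      ≤ ((min m n + 1 : ℕ) * ∑ k ∈ Finset.range (min m n + 1), ‖a k‖ ^ 2) / (m ! * n !) := by
        gcongr
    _ = (min m n + 1 : ℕ) * ∑ k ∈ Finset.range (min m n + 1), ‖a k‖ ^ 2 / (m ! * n !) := by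
        rw [mul_div_assoc, Finset.sum_div]
    _ ≤ (min m n + 1 : ℕ) * ((min m n + 1 : ℕ) * ((u ^ m * E₁) * (u ^ n * E₂))) := by
        gcongr
        simpa using Finset.sum_le_card_nsmul _ _ _ h_term
    _ ≤ (m + 1 : ℕ) * ((n + 1 : ℕ) * ((u ^ m * E₁) * (u ^ n * E₂))) := by
        gcongr
        · exact min_le_left m n
        · exact min_le_right m n
    _ = _ := by
        push_cast
        ring

theorem summable_succ_mul_geometric {q : ℝ} (hq0 : 0 ≤ q) (hq1 : q < 1) :
    Summable (fun m : ℕ => ((m : ℝ) + 1) * q ^ m) := by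
  have hq : ‖q‖ < 1 := by rwa [Real.norm_of_nonneg hq0]
  have h := (summable_pow_mul_geometric_of_norm_lt_one 1 hq).add
    (summable_geometric_of_lt_one hq0 hq1)
  simpa [add_mul] using h

theorem norm_sq_holomorphicHermite2 {α : ℝ} (hα0 : 0 < α) (hα1 : α < 1) (m n : ℕ) (z₁ z₂ : ℂ) :
    ‖holomorphicHermite2 α m n z₁ z₂‖ ^ 2 =
      (2 * Real.sqrt α / (1 + α)) ^ 2 *
        ‖Complex.exp ((((1 - α) / (1 + α) : ℝ) : ℂ) * z₁ * z₂)‖ ^ 2 *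
        ((1 - α) / (1 + α)) ^ (m + n) *
        (‖complexHermite m n (((2 * Real.sqrt α / Real.sqrt (1 - α ^ 2) : ℝ) : ℂ) * z₁)
          (((2 * Real.sqrt α / Real.sqrt (1 - α ^ 2) : ℝ) : ℂ) * z₂)‖ ^ 2 / (m ! * n !)) := by
  have ht : 0 ≤ (1 - α) / (1 + α) := div_nonneg (by linarith) (by linarith)
  have h_sqrt : Real.sqrt ((1 - α) / (1 + α)) ^ 2 = (1 - α) / (1 + α) := Real.sq_sqrt ht
  have h_fact : Real.sqrt ((m ! : ℝ) * n !) ^ 2 = m ! * n ! := Real.sq_sqrt (by positivity)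
  rw [holomorphicHermite2]
  simp only [norm_mul, norm_pow, norm_div, norm_one, Complex.norm_real, mul_pow, Real.norm_eq_abs,
    sq_abs, div_pow, one_pow, abs_of_nonneg (Real.sqrt_nonneg _)]
  rw [h_fact, ← pow_mul, mul_comm (m + n) 2, pow_mul, h_sqrt, div_pow]
  ring

/-- For every `0 < α < 1` and all `z₁ z₂ ∈ ℂ`, the double series
`∑_{m,n} |h_{m,n}^{(α)}(z₁,z₂)|²` converges. -/
theorem holomorphicHermite2_sq_summable (α : ℝ) (hα0 : 0 < α) (hα1 : α < 1) (z₁ z₂ : ℂ) :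
    Summable (fun p : ℕ × ℕ => ‖holomorphicHermite2 α p.1 p.2 z₁ z₂‖ ^ 2) := by
  set t := (1 - α) / (1 + α) with ht
  have ht0 : 0 < t := div_pos (by linarith) (by linarith)
  have ht1 : t < 1 := by
    rw [ht, div_lt_one (by linarith)]
    linarith
  set u := (t + 1) / (2 * t) with hu_def
  have hu : 1 < u := by
    rw [hu_def, lt_div_iff₀ (by positivity)]
    linarith
  have htu : t * u = (t + 1) / 2 := by
    rw [hu_def]
    field_simp
  have h_geom := summable_succ_mul_geometric (q := t * u) (by positivity) (by linarith)
  have h_prod := h_geom.mul_of_nonneg h_geom (fun m => by positivity) (fun m => by positivity)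
  set w₁ : ℂ := ((2 * Real.sqrt α / Real.sqrt (1 - α ^ 2) : ℝ) : ℂ) * z₁ with hw₁
  set w₂ : ℂ := ((2 * Real.sqrt α / Real.sqrt (1 - α ^ 2) : ℝ) : ℂ) * z₂ with hw₂
  set C := (2 * Real.sqrt α / (1 + α)) ^ 2 * ‖Complex.exp ((t : ℂ) * z₁ * z₂)‖ ^ 2 with hC
  refine Summable.of_nonneg_of_le (fun p => by positivity) (fun p => ?_)
    (h_prod.mul_left
      (C * (Real.exp (‖w₁‖ ^ 2 / (u - 1)) * Real.exp (‖w₂‖ ^ 2 / (u - 1)))))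
  rw [norm_sq_holomorphicHermite2 hα0 hα1, ← ht, ← hw₁, ← hw₂, ← hC]
  refine (mul_le_mul_of_nonneg_left (norm_sq_complexHermite_div_le hu w₁ w₂ p.1 p.2)
    (by positivity)).trans_eq ?_
  rw [mul_pow, mul_pow, pow_add]
  ring
end

section
/- Let n ≥ 1, let ℏ > 0, and let M be a positive definite real symmetric n×n matrix. Define the generalized Gaussian ψ_M : ℝⁿ → ℝ by ψ_M(r) = π^{−n/4} (det M)^{1/4} exp(−½ rᵀ M r). Then for all x, p ∈ ℝⁿ, (2πℏ)^{−n} ∫_{ℝⁿ} exp(−(i/ℏ) p·X) · ψ_M(x + X/2) · ψ_M(x − X/2) dX = (πℏ)^{−n} exp(−xᵀ M x − ℏ^{−2} pᵀ M^{−1} p). -/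
open MeasureTheory

/-- The normalized generalized Gaussian
`ψ_M(r) = π^{−n/4} (det M)^{1/4} exp(−½ rᵀ M r)` on `ℝⁿ`. -/
noncomputable def gaussianPsi (n : ℕ) (M : Matrix (Fin n) (Fin n) ℝ)
    (r : EuclideanSpace ℝ (Fin n)) : ℝ :=
  Real.pi ^ (-(n : ℝ) / 4) * M.det ^ ((1 : ℝ) / 4) *
    Real.exp (-(1 / 2) * ∑ i, ∑ j, r i * M i j * r j)

open scoped MatrixOrder Matrix.Norms.L2Operator in
theorem Matrix.PosDef.exists_transpose_mul_self {ι : Type*} [Fintype ι] [DecidableEq ι]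
    {M : Matrix ι ι ℝ} (hM : M.PosDef) :
    ∃ B : Matrix ι ι ℝ, M = B.transpose * B ∧ B.det ≠ 0 := by
  obtain ⟨B, hB⟩ := CStarAlgebra.nonneg_iff_eq_star_mul_self.mp hM.posSemidef.nonneg
  rw [Matrix.star_eq_conjTranspose, Matrix.conjTranspose_eq_transpose_of_trivial] at hB
  refine ⟨B, hB, fun h => hM.det_pos.ne' ?_⟩
  rw [hB, Matrix.det_mul, h, mul_zero]

theorem integral_comp_mulVec {ι : Type*} [Fintype ι] [DecidableEq ι] {B : Matrix ι ι ℝ}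
    (hB : B.det ≠ 0) (f : (ι → ℝ) → ℂ) :
    ∫ v : ι → ℝ, f (B.mulVec v) = ((|B.det|⁻¹ : ℝ) : ℂ) * ∫ v : ι → ℝ, f v := by
  let e : (ι → ℝ) ≃ₗ[ℝ] (ι → ℝ) := Matrix.toLin'OfInv
    (Matrix.nonsing_inv_mul B hB.isUnit) (Matrix.mul_nonsing_inv B hB.isUnit)
  have hmap := Real.map_matrix_volume_pi_eq_smul_volume_pi hB
  have he : MeasurableEmbedding (Matrix.toLin' B) :=
    e.toContinuousLinearEquiv.toHomeomorph.measurableEmbedding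
  have := he.integral_map (μ := volume) f
  rw [hmap, integral_smul_measure, ENNReal.toReal_ofReal (abs_nonneg _), abs_inv] at this
  simpa [Matrix.toLin'_apply, Complex.real_smul] using this.symm

open Matrix in
/-- The Fourier–Laplace transform of the Gaussian `exp (-b vᵀ M v)`. -/
theorem integral_cexp_neg_mul_quadratic_add {ι : Type*} [Fintype ι] [DecidableEq ι]
    {M : Matrix ι ι ℝ} (hM : M.PosDef) {b : ℂ} (hb : 0 < b.re) (c : ℂ) (w : ι → ℝ) :
    ∫ v : ι → ℝ, Complex.exp (-b * ((v ⬝ᵥ M *ᵥ v : ℝ) : ℂ) + c * ((w ⬝ᵥ v : ℝ) : ℂ)) =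
      ((√M.det)⁻¹ : ℝ) * ((Real.pi / b) ^ (Fintype.card ι / 2 : ℂ) *
        Complex.exp (c ^ 2 * ((w ⬝ᵥ M⁻¹ *ᵥ w : ℝ) : ℂ) / (4 * b))) := by
  obtain ⟨B, rfl, hB⟩ := hM.exists_transpose_mul_self
  have hinv : B⁻¹ * B = 1 := nonsing_inv_mul B hB.isUnit
  have key := integral_comp_mulVec hB fun u =>
    Complex.exp (-b * ∑ i, (u i : ℂ) ^ 2 + ∑ i, (c * ((w ᵥ* B⁻¹) i : ℂ)) * u i)
  rw [GaussianFourier.integral_cexp_neg_mul_sum_add hb] at key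
  convert key using 1
  · congr with v
    have h1 : v ⬝ᵥ (Bᵀ * B) *ᵥ v = ∑ i, (B *ᵥ v) i ^ 2 := by
      rw [← mulVec_mulVec, dotProduct_mulVec, vecMul_transpose, dotProduct]
      simp [sq]
    have h2 : w ⬝ᵥ v = ∑ i, (w ᵥ* B⁻¹) i * (B *ᵥ v) i := by
      change _ = (w ᵥ* B⁻¹) ⬝ᵥ (B *ᵥ v)
      rw [← dotProduct_mulVec, mulVec_mulVec, hinv, one_mulVec]
    rw [h1, h2]
    push_cast
    simp [Finset.mul_sum, mul_assoc]
  · have h1 : w ⬝ᵥ (Bᵀ * B)⁻¹ *ᵥ w = ∑ i, (w ᵥ* B⁻¹) i ^ 2 := by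
      rw [Matrix.mul_inv_rev, ← mulVec_mulVec, dotProduct_mulVec, ← transpose_nonsing_inv,
        mulVec_transpose, dotProduct]
      simp [sq]
    rw [det_mul, det_transpose, Real.sqrt_mul_self_eq_abs, h1]
    push_cast
    simp [Finset.mul_sum, mul_pow]

open Matrix in
theorem gaussianPsi_eq_dotProduct (n : ℕ) (M : Matrix (Fin n) (Fin n) ℝ)
    (r : EuclideanSpace ℝ (Fin n)) :
    gaussianPsi n M r = Real.pi ^ (-(n : ℝ) / 4) * M.det ^ ((1 : ℝ) / 4) *
      Real.exp (-(1 / 2) * (r.ofLp ⬝ᵥ M *ᵥ r.ofLp)) := by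
  simp [gaussianPsi, dotProduct, mulVec, Finset.mul_sum, mul_assoc]

open Matrix in
theorem gaussianPsi_add_mul_gaussianPsi_sub {n : ℕ} {M : Matrix (Fin n) (Fin n) ℝ}
    (hM : 0 ≤ M.det) (x y : EuclideanSpace ℝ (Fin n)) :
    gaussianPsi n M (x + y) * gaussianPsi n M (x - y) =
      (√Real.pi ^ n)⁻¹ * √M.det *
        Real.exp (-(x.ofLp ⬝ᵥ M *ᵥ x.ofLp) - y.ofLp ⬝ᵥ M *ᵥ y.ofLp) := by
  have hpi : Real.pi ^ (-(n : ℝ) / 4) * Real.pi ^ (-(n : ℝ) / 4) = (√Real.pi ^ n)⁻¹ := by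
    rw [← Real.rpow_add Real.pi_pos, Real.sqrt_eq_rpow, ← Real.rpow_mul_natCast Real.pi_pos.le,
      ← Real.rpow_neg Real.pi_pos.le]
    ring_nf
  have hdet : M.det ^ ((1 : ℝ) / 4) * M.det ^ ((1 : ℝ) / 4) = √M.det := by
    rw [← Real.rpow_add_of_nonneg hM (by norm_num) (by norm_num), Real.sqrt_eq_rpow]
    norm_num
  have hexp : Real.exp (-(1 / 2) * ((x + y).ofLp ⬝ᵥ M *ᵥ (x + y).ofLp)) *
      Real.exp (-(1 / 2) * ((x - y).ofLp ⬝ᵥ M *ᵥ (x - y).ofLp)) =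
      Real.exp (-(x.ofLp ⬝ᵥ M *ᵥ x.ofLp) - y.ofLp ⬝ᵥ M *ᵥ y.ofLp) := by
    rw [← Real.exp_add]
    simp only [WithLp.ofLp_add, WithLp.ofLp_sub, mulVec_add, mulVec_sub, add_dotProduct,
      sub_dotProduct, dotProduct_add, dotProduct_sub]
    ring_nf
  rw [gaussianPsi_eq_dotProduct, gaussianPsi_eq_dotProduct, ← hpi, ← hdet, ← hexp]
  ring

/-- The Wigner transform of the normalized generalized Gaussian `ψ_M` is the
phase-space Gaussian: for a positive definite real symmetric `n×n` matrix `M`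
(`n ≥ 1`) and `ℏ > 0`, for all `x, p ∈ ℝⁿ`,
`(2πℏ)^{−n} ∫ e^{−(i/ℏ) p·X} ψ_M(x+X/2) ψ_M(x−X/2) dX
  = (πℏ)^{−n} exp(−xᵀMx − ℏ^{−2} pᵀM^{−1}p)`. -/
theorem wigner_transform_generalized_gaussian (n : ℕ) (hn : 1 ≤ n) (ℏ : ℝ) (hℏ : 0 < ℏ)
    (M : Matrix (Fin n) (Fin n) ℝ) (hMsym : M.IsSymm) (hMpos : M.PosDef)
    (x p : EuclideanSpace ℝ (Fin n)) :
    ((((2 * Real.pi * ℏ) ^ n : ℝ) : ℂ))⁻¹ *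
        ∫ X : EuclideanSpace ℝ (Fin n),
          Complex.exp (-(Complex.I / (ℏ : ℂ)) * ((∑ i, p i * X i : ℝ) : ℂ)) *
            ((gaussianPsi n M (x + (2 : ℝ)⁻¹ • X) : ℝ) : ℂ) *
            ((gaussianPsi n M (x - (2 : ℝ)⁻¹ • X) : ℝ) : ℂ) =
      ((((Real.pi * ℏ) ^ n : ℝ) : ℂ))⁻¹ *
        Complex.exp (-((∑ i, ∑ j, x i * M i j * x j : ℝ) : ℂ) -
          ((ℏ : ℂ) ^ 2)⁻¹ * ((∑ i, ∑ j, p i * M⁻¹ i j * p j : ℝ) : ℂ)) := by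
  have hdet := hMpos.det_pos
  have hsum (N : Matrix (Fin n) (Fin n) ℝ) (r : EuclideanSpace ℝ (Fin n)) :
      ∑ i, ∑ j, r i * N i j * r j = r.ofLp ⬝ᵥ N.mulVec r.ofLp := by
    simp [dotProduct, Matrix.mulVec, Finset.mul_sum, mul_assoc]
  have hint (X : EuclideanSpace ℝ (Fin n)) :
      Complex.exp (-(Complex.I / (ℏ : ℂ)) * ((∑ i, p i * X i : ℝ) : ℂ)) *
        ((gaussianPsi n M (x + (2 : ℝ)⁻¹ • X) : ℝ) : ℂ) *
        ((gaussianPsi n M (x - (2 : ℝ)⁻¹ • X) : ℝ) : ℂ) =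
      (((√Real.pi ^ n)⁻¹ * √M.det : ℝ) : ℂ) *
        Complex.exp (-((x.ofLp ⬝ᵥ M.mulVec x.ofLp : ℝ) : ℂ)) *
        Complex.exp (-(1 / 4) * ((X.ofLp ⬝ᵥ M.mulVec X.ofLp : ℝ) : ℂ) +
          -(Complex.I / (ℏ : ℂ)) * ((p.ofLp ⬝ᵥ X.ofLp : ℝ) : ℂ)) := by
    rw [mul_assoc, ← Complex.ofReal_mul, gaussianPsi_add_mul_gaussianPsi_sub hdet.le,
      Complex.ofReal_mul, Complex.ofReal_exp, mul_left_comm, ← Complex.exp_add, mul_assoc,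
      ← Complex.exp_add]
    congr 1
    simp only [WithLp.ofLp_smul, Matrix.mulVec_smul, smul_dotProduct, dotProduct_smul,
      smul_eq_mul]
    change Complex.exp (-(Complex.I / (ℏ : ℂ)) * ((p.ofLp ⬝ᵥ X.ofLp : ℝ) : ℂ) + _) = _
    congr 1
    push_cast
    ring
  simp_rw [hint, hsum]
  rw [integral_const_mul, ← (PiLp.volume_preserving_toLp (Fin n)).integral_comp
    (MeasurableEquiv.toLp 2 _).measurableEmbedding,
    integral_cexp_neg_mul_quadratic_add hMpos (by norm_num)]
  have hpow : ((Real.pi : ℂ) / (1 / 4)) ^ ((Fintype.card (Fin n) : ℂ) / 2) =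
      ((2 ^ n * √Real.pi ^ n : ℝ) : ℂ) := by
    have h : (Real.pi : ℂ) / (1 / 4) = (((2 * √Real.pi) ^ 2 : ℝ) : ℂ) := by
      rw [mul_pow, Real.sq_sqrt Real.pi_pos.le]
      push_cast
      ring
    have h' : ((Fintype.card (Fin n) : ℂ) / 2) = (((n : ℝ) / 2 : ℝ) : ℂ) := by simp
    rw [h, h', ← Complex.ofReal_cpow (by positivity), ← Real.rpow_natCast_mul (by positivity),
      ← mul_pow, ← Real.rpow_natCast]
    congr 2
    push_cast
    ring
  have hexp : (-(Complex.I / (ℏ : ℂ))) ^ 2 * ((p.ofLp ⬝ᵥ M⁻¹.mulVec p.ofLp : ℝ) : ℂ) /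
      (4 * (1 / 4)) = -(((ℏ : ℂ) ^ 2)⁻¹ * ((p.ofLp ⬝ᵥ M⁻¹.mulVec p.ofLp : ℝ) : ℂ)) := by
    rw [neg_sq, div_pow, Complex.I_sq]
    ring
  have hpi : (√Real.pi : ℂ) ≠ 0 := by
    exact_mod_cast (Real.sqrt_pos.mpr Real.pi_pos).ne'
  have hpi' : (Real.pi : ℂ) ≠ 0 := by exact_mod_cast Real.pi_ne_zero
  have hd : (√M.det : ℂ) ≠ 0 := by exact_mod_cast (Real.sqrt_pos.mpr hdet).ne'
  have hh : (ℏ : ℂ) ≠ 0 := by exact_mod_cast hℏ.ne'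
  rw [hpow, hexp, sub_eq_add_neg, Complex.exp_add]
  push_cast
  field_simp
  rw [← mul_pow, ← mul_assoc]
end

section
/- Let ℏ > 0, a, b > 0 and 0 < α < 1. Then the complex Hermitian 4×4 matrix Σ_{2,α} + (iℏ/2) J is positive semidefinite (the Robertson–Schrödinger uncertainty relation holds for the covariance matrix Σ_{2,α}). -/
open scoped ComplexOrder

/-- The standard symplectic matrix `J = [[0, I₂], [−I₂, 0]]` for the phase-space
ordering `(x₁, x₂, p₁, p₂)`. -/
def Jmat : Matrix (Fin 4) (Fin 4) ℝ :=
  !![0, 0, 1, 0; 0, 0, 0, 1; -1, 0, 0, 0; 0, -1, 0, 0]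

/-- The covariance matrix `Σ_{2,α}` of the Wigner function of the two-mode-squeezed
bipartite Gaussian state. -/
noncomputable def Sigma2 (ℏ a b α : ℝ) : Matrix (Fin 4) (Fin 4) ℝ :=
  (1 / (4 * α)) •
    !![(1 + α ^ 2) / a ^ 2, (α ^ 2 - 1) / (a * b), 0, 0;
       (α ^ 2 - 1) / (a * b), (1 + α ^ 2) / b ^ 2, 0, 0;
       0, 0, (1 + α ^ 2) * a ^ 2 * ℏ ^ 2, (1 - α ^ 2) * a * b * ℏ ^ 2;
       0, 0, (1 - α ^ 2) * a * b * ℏ ^ 2, (1 + α ^ 2) * b ^ 2 * ℏ ^ 2]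

/-- A `4 × 2` matrix `B` such that `B Bᴴ` is a multiple of `Σ_{2,α} + (iℏ/2) J`. -/
noncomputable def uncertaintyFactor (ℏ a b α : ℝ) : Matrix (Fin 4) (Fin 2) ℂ :=
  !![α / a, 1 / a;
     α / b, -1 / b;
     -Complex.I * a * ℏ, -Complex.I * α * a * ℏ;
     -Complex.I * b * ℏ, Complex.I * α * b * ℏ]

theorem Sigma2_add_Jmat_eq_smul_mul_conjTranspose (ℏ : ℝ) {a b α : ℝ} (ha : a ≠ 0) (hb : b ≠ 0)
    (hα : α ≠ 0) :
    (Sigma2 ℏ a b α).map (Complex.ofReal) +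
        ((Complex.I * (ℏ : ℂ)) / 2) • Jmat.map (Complex.ofReal) =
      ((1 / (4 * α) : ℝ) : ℂ) •
        (uncertaintyFactor ℏ a b α * (uncertaintyFactor ℏ a b α).conjTranspose) := by
  ext i j
  simp only [Matrix.add_apply, Matrix.smul_apply, Matrix.mul_apply, Matrix.map_apply,
    Matrix.conjTranspose_apply, Fin.sum_univ_two]
  fin_cases i <;> fin_cases j <;>
    simp [Sigma2, Jmat, uncertaintyFactor, hα] <;>
    field_simp <;> ring_nf <;> simp only [Complex.I_sq] <;> ring

/-- The Robertson–Schrödinger uncertainty relation for the covariance matrix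
`Σ_{2,α}`: the complex Hermitian matrix `Σ_{2,α} + (iℏ/2) J` is positive
semidefinite. -/
theorem robertson_schrodinger_Sigma2 (ℏ a b α : ℝ) (hℏ : 0 < ℏ) (ha : 0 < a)
    (hb : 0 < b) (hα0 : 0 < α) (hα1 : α < 1) :
    Matrix.PosSemidef
      ((Sigma2 ℏ a b α).map (Complex.ofReal) +
        ((Complex.I * (ℏ : ℂ)) / 2) • Jmat.map (Complex.ofReal)) := by
  rw [Sigma2_add_Jmat_eq_smul_mul_conjTranspose ℏ ha.ne' hb.ne' hα0.ne']
  refine (Matrix.posSemidef_self_mul_conjTranspose _).smul ?_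
  exact_mod_cast (by positivity : (0 : ℝ) ≤ 1 / (4 * α))
end

section
/- Let ℏ > 0, a, b > 0 and 0 < α < 1. Let Λ = diag(1,1,1,−1) and Σ̃_{2,α} = Λ Σ_{2,α} Λᵀ. Then the complex Hermitian 4×4 matrix Σ̃_{2,α} + (iℏ/2) J is NOT positive semidefinite; i.e. the Simon–Horodecki–Peres separability criterion is violated, so the corresponding bipartite Gaussian state is entangled. -/
open scoped ComplexOrder

/-- The partial-transpose matrix `Λ = diag(1,1,1,−1)`. -/
def Lambda : Matrix (Fin 4) (Fin 4) ℝ := Matrix.diagonal ![1, 1, 1, -1]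

/-- Violation of the Simon–Horodecki–Peres separability criterion for the
two-mode-squeezed state: with `Σ̃_{2,α} = Λ Σ_{2,α} Λᵀ`, the Hermitian matrix
`Σ̃_{2,α} + (iℏ/2)J` is NOT positive semidefinite, so the state is entangled. -/
theorem separability_violated_Sigma2 (ℏ a b α : ℝ) (hℏ : 0 < ℏ) (ha : 0 < a)
    (hb : 0 < b) (hα0 : 0 < α) (hα1 : α < 1) :
    ¬ Matrix.PosSemidef
        ((Lambda * Sigma2 ℏ a b α * Lambda.transpose).map (Complex.ofReal) +
          ((Complex.I * (ℏ : ℂ)) / 2) • Jmat.map (Complex.ofReal)) := by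
  intro h
  have hv := h.dotProduct_mulVec_nonneg
    ![(a : ℂ), (b : ℂ), Complex.I / (a * ℏ), Complex.I / (b * ℏ)]
  have hℏ' : (ℏ : ℂ) ≠ 0 := Complex.ofReal_ne_zero.mpr hℏ.ne'
  have ha' : (a : ℂ) ≠ 0 := Complex.ofReal_ne_zero.mpr ha.ne'
  have hb' : (b : ℂ) ≠ 0 := Complex.ofReal_ne_zero.mpr hb.ne'
  have hα' : (α : ℂ) ≠ 0 := Complex.ofReal_ne_zero.mpr hα0.ne'
  have key : star ![(a : ℂ), (b : ℂ), Complex.I / (a * ℏ), Complex.I / (b * ℏ)] ⬝ᵥ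
      (((Lambda * Sigma2 ℏ a b α * Lambda.transpose).map (Complex.ofReal) +
          ((Complex.I * (ℏ : ℂ)) / 2) • Jmat.map (Complex.ofReal)).mulVec
        ![(a : ℂ), (b : ℂ), Complex.I / (a * ℏ), Complex.I / (b * ℏ)])
      = ((2 * α - 2 : ℝ) : ℂ) := by
    simp [dotProduct, Matrix.mulVec, Fin.sum_univ_four, Lambda, Sigma2, Jmat,
      Matrix.diagonal_mul, Matrix.mul_diagonal]
    field_simp
    ring_nf
    simp only [Complex.I_sq]
    ring
  rw [key, Complex.zero_le_real] at hv
  linarith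
end

section
/- Let ℏ > 0, a, b > 0 and 0 < α < 1. Let Λ = diag(1,1,1,−1) and Σ̃_{2,α} = Λ Σ_{2,α} Λᵀ. Then for every λ ∈ ℂ, det(J Σ̃_{2,α} − λ I₄) = (λ² + ℏ²α²/4)(λ² + ℏ²/(4α²)); in particular, the eigenvalues of J Σ̃_{2,α} are exactly ± iℏα/2 and ± iℏ/(2α), so the symplectic spectrum of Σ̃_{2,α} is {ℏα/2, ℏ/(2α)}. -/
/-- The matrix `J Σ̃_{2,α}` written out entrywise. -/
theorem Jmat_mul_Sigma2_tilde (ℏ a b α : ℝ) :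
    Jmat * (Lambda * Sigma2 ℏ a b α * Lambda.transpose) =
      (1 / (4 * α)) •
        !![0, 0, (1 + α ^ 2) * a ^ 2 * ℏ ^ 2, -((1 - α ^ 2) * a * b * ℏ ^ 2);
           0, 0, -((1 - α ^ 2) * a * b * ℏ ^ 2), (1 + α ^ 2) * b ^ 2 * ℏ ^ 2;
           -((1 + α ^ 2) / a ^ 2), -((α ^ 2 - 1) / (a * b)), 0, 0;
           -((α ^ 2 - 1) / (a * b)), -((1 + α ^ 2) / b ^ 2), 0, 0] := by
  ext i j
  fin_cases i <;> fin_cases j <;>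
    simp [Jmat, Lambda, Sigma2, Matrix.mul_apply, Fin.sum_univ_four, Matrix.diagonal_apply]

/-- The characteristic determinant of `J Σ̃_{2,α}`. -/
theorem det_Jmat_mul_Sigma2_tilde_sub (ℏ a b α : ℝ) (ha : a ≠ 0) (hb : b ≠ 0) (hα : α ≠ 0)
    (lam : ℂ) :
    Matrix.det
        ((Jmat * (Lambda * Sigma2 ℏ a b α * Lambda.transpose)).map Complex.ofReal -
          lam • (1 : Matrix (Fin 4) (Fin 4) ℂ)) =
      (lam ^ 2 + (ℏ : ℂ) ^ 2 * (α : ℂ) ^ 2 / 4) *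
        (lam ^ 2 + (ℏ : ℂ) ^ 2 / (4 * (α : ℂ) ^ 2)) := by
  have ha' : (a : ℂ) ≠ 0 := by exact_mod_cast ha
  have hb' : (b : ℂ) ≠ 0 := by exact_mod_cast hb
  have hα' : (α : ℂ) ≠ 0 := by exact_mod_cast hα
  rw [Jmat_mul_Sigma2_tilde]
  simp [Matrix.det_succ_row_zero, Fin.sum_univ_succ, Fin.succAbove, Matrix.one_apply]
  field_simp
  ring

/-- The symplectic spectrum of the partially transposed covariance matrix
`Σ̃_{2,α} = Λ Σ_{2,α} Λᵀ`: for every `λ ∈ ℂ`,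
`det(J Σ̃_{2,α} − λ I₄) = (λ² + ℏ²α²/4)(λ² + ℏ²/(4α²))`, and the eigenvalues of
`J Σ̃_{2,α}` are exactly `± iℏα/2` and `± iℏ/(2α)`, so the symplectic spectrum of
`Σ̃_{2,α}` is `{ℏα/2, ℏ/(2α)}`. -/
theorem symplectic_spectrum_Sigma2_tilde (ℏ a b α : ℝ) (hℏ : 0 < ℏ) (ha : 0 < a)
    (hb : 0 < b) (hα0 : 0 < α) (hα1 : α < 1) :
    (∀ lam : ℂ,
        Matrix.det
            ((Jmat * (Lambda * Sigma2 ℏ a b α * Lambda.transpose)).map Complex.ofReal -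
              lam • (1 : Matrix (Fin 4) (Fin 4) ℂ)) =
          (lam ^ 2 + (ℏ : ℂ) ^ 2 * (α : ℂ) ^ 2 / 4) *
            (lam ^ 2 + (ℏ : ℂ) ^ 2 / (4 * (α : ℂ) ^ 2))) ∧
      (∀ μ : ℂ,
        μ ∈ spectrum ℂ
            ((Jmat * (Lambda * Sigma2 ℏ a b α * Lambda.transpose)).map Complex.ofReal) ↔
          μ = Complex.I * (ℏ : ℂ) * (α : ℂ) / 2 ∨
          μ = -(Complex.I * (ℏ : ℂ) * (α : ℂ) / 2) ∨
          μ = Complex.I * (ℏ : ℂ) / (2 * (α : ℂ)) ∨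
          μ = -(Complex.I * (ℏ : ℂ) / (2 * (α : ℂ)))) := by
  have hdet := det_Jmat_mul_Sigma2_tilde_sub ℏ a b α ha.ne' hb.ne' hα0.ne'
  refine ⟨hdet, fun μ => ?_⟩
  have hα : (α : ℂ) ≠ 0 := by exact_mod_cast hα0.ne'
  have h₁ : μ ^ 2 + (ℏ : ℂ) ^ 2 * (α : ℂ) ^ 2 / 4 =
      μ ^ 2 - (Complex.I * (ℏ : ℂ) * (α : ℂ) / 2) ^ 2 := by
    linear_combination ((ℏ : ℂ) ^ 2 * (α : ℂ) ^ 2 / 4) * Complex.I_sq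
  have h₂ : μ ^ 2 + (ℏ : ℂ) ^ 2 / (4 * (α : ℂ) ^ 2) =
      μ ^ 2 - (Complex.I * (ℏ : ℂ) / (2 * (α : ℂ))) ^ 2 := by
    rw [div_pow, mul_pow, Complex.I_sq]
    ring
  rw [spectrum.mem_iff, ← IsUnit.neg_iff, neg_sub, Algebra.algebraMap_eq_smul_one,
    Matrix.isUnit_iff_isUnit_det, isUnit_iff_ne_zero, not_not, hdet μ, mul_eq_zero, h₁, h₂,
    sub_eq_zero, sub_eq_zero, sq_eq_sq_iff_eq_or_eq_neg, sq_eq_sq_iff_eq_or_eq_neg, or_assoc]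
end
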